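/- arXiv:1008.4713 — 4 statements merged into one kernel-verified Lean document; each statement's English description precedes it below -/
import Mathlib

section
/- For every α ∈ (1,2) and every x > 0, the function v_α(t) = (-sin(πα)) t^{α-2}(1+t) / (π(t^{2α} - 2t^α cos(πα) + 1)) is nonnegative on (0,∞) and satisfies ∫₀^∞ v_α(t) dt = 1, i.e. v_α is a probability density on (0,∞). -/
open Real MeasureTheory Set

open Filter Topology

/-- The entire extension across `0` of `w ↦ e^{(α-1)w} (e^w - 1) / (e^{αw} - 1)`, written as a
quotient of entire functions. -/
noncomputable def expKernel (α : ℝ) (w : ℂ) : ℂ :=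
  Complex.exp ((α - 1) * w) * dslope Complex.exp 0 w /
    dslope (fun z : ℂ => Complex.exp (α * z)) 0 w

theorem expKernel_of_ne (α : ℝ) {w : ℂ} (hw : w ≠ 0) :
    expKernel α w =
      Complex.exp ((α - 1) * w) * (Complex.exp w - 1) / (Complex.exp (α * w) - 1) := by
  simp only [expKernel, dslope_of_ne _ hw, slope_def_field, mul_zero, Complex.exp_zero, sub_zero]
  rw [mul_div_assoc, div_div_div_cancel_right₀ hw, mul_div_assoc]

theorem deriv_cexp_const_mul_zero (a : ℂ) :
    deriv (fun z : ℂ => Complex.exp (a * z)) 0 = a := by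
  have h : HasDerivAt (fun z : ℂ => Complex.exp (a * z)) (Complex.exp (a * 0) * (a * 1)) 0 :=
    ((hasDerivAt_id (0 : ℂ)).const_mul a).cexp
  simpa using h.deriv

theorem differentiable_dslope_of_differentiable {f : ℂ → ℂ} (hf : Differentiable ℂ f) (c : ℂ) :
    Differentiable ℂ (dslope f c) := by
  rw [← differentiableOn_univ, Complex.differentiableOn_dslope univ_mem]
  exact hf.differentiableOn

theorem cexp_mul_ne_one_of_im_mem_Icc {α : ℝ} (h0 : 0 < α) (h2 : α < 2) {w : ℂ} (hw : w ≠ 0)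
    (him : w.im ∈ Icc 0 π) : Complex.exp (α * w) ≠ 1 := by
  intro h
  obtain ⟨n, hn⟩ := Complex.exp_eq_one_iff.1 h
  have hre : α * w.re = 0 := by simpa using congrArg Complex.re hn
  have him' : α * w.im = n * (2 * π) := by simpa using congrArg Complex.im hn
  have hp := Real.pi_pos
  have hlt : (n : ℝ) < 1 := by
    have : α * w.im ≤ α * π := mul_le_mul_of_nonneg_left him.2 h0.le
    nlinarith
  have hgt : (-1 : ℝ) < n := by
    have : 0 ≤ α * w.im := mul_nonneg h0.le him.1
    nlinarith
  have hn0 : n = 0 := by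
    have h1 : n < 1 := by exact_mod_cast hlt
    have h3 : -1 < n := by exact_mod_cast hgt
    omega
  refine hw (Complex.ext ?_ ?_)
  · simpa [h0.ne'] using hre
  · simpa [hn0, h0.ne'] using him'

theorem differentiableOn_expKernel {α : ℝ} (h0 : 0 < α) (h2 : α < 2) :
    DifferentiableOn ℂ (expKernel α) {w | w.im ∈ Icc 0 π} := by
  have hd : Differentiable ℂ (fun z : ℂ => Complex.exp (α * z)) := by fun_prop
  have hd' : Differentiable ℂ (fun z : ℂ => Complex.exp ((α - 1) * z)) := by fun_prop
  refine ((hd'.mul (differentiable_dslope_of_differentiable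
    Complex.differentiable_exp 0)).differentiableOn).div
    (differentiable_dslope_of_differentiable hd 0).differentiableOn ?_
  intro w hw
  rcases eq_or_ne w 0 with rfl | hne
  · rw [dslope_same, deriv_cexp_const_mul_zero]
    exact_mod_cast h0.ne'
  · rw [dslope_of_ne _ hne, slope_def_field]
    refine div_ne_zero ?_ (by simpa using hne)
    simpa [sub_eq_zero] using cexp_mul_ne_one_of_im_mem_Icc h0 h2 hne hw

theorem expKernel_ofReal_im (α x : ℝ) : (expKernel α x).im = 0 := by
  rcases eq_or_ne x 0 with rfl | hx
  · rw [Complex.ofReal_zero, expKernel, dslope_same, dslope_same, deriv_cexp_const_mul_zero,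
      Complex.deriv_exp]
    simp
  · rw [expKernel_of_ne α (by exact_mod_cast hx)]
    have : Complex.exp ((α - 1) * x) * (Complex.exp x - 1) / (Complex.exp (α * x) - 1) =
        ((Real.exp ((α - 1) * x) * (Real.exp x - 1) / (Real.exp (α * x) - 1) : ℝ) : ℂ) := by
      push_cast
      rfl
    rw [this, Complex.ofReal_im]

/-- The imaginary part of the boundary value of `expKernel` on the line `im w = π`. -/
theorem expKernel_add_pi_im {α : ℝ} (hs : Real.sin (π * α) ≠ 0) (x : ℝ) :
    (expKernel α (x + π * Complex.I)).im =
      -Real.sin (π * α) * Real.exp ((α - 1) * x) * (1 + Real.exp x) /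
        (Real.exp (2 * α * x) - 2 * Real.exp (α * x) * Real.cos (π * α) + 1) := by
  have hne : (x + π * Complex.I : ℂ) ≠ 0 := by
    intro h
    have := congrArg Complex.im h
    simp [Real.pi_ne_zero] at this
  have e1 : Complex.exp (x + π * Complex.I) = ((-Real.exp x : ℝ) : ℂ) := by
    rw [Complex.exp_add, Complex.exp_pi_mul_I]; push_cast; ring
  have e2 : Complex.exp (α * (x + π * Complex.I)) =
      Real.exp (α * x) * (Real.cos (π * α) + Real.sin (π * α) * Complex.I) := by
    rw [show (α * (x + π * Complex.I) : ℂ) = (α * x : ℝ) + (π * α : ℝ) * Complex.I by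
      push_cast; ring, Complex.exp_add, Complex.exp_mul_I]
    push_cast; rfl
  have e3 : Complex.exp ((α - 1) * (x + π * Complex.I)) =
      -(Real.exp ((α - 1) * x) * (Real.cos (π * α) + Real.sin (π * α) * Complex.I)) := by
    rw [show ((α - 1) * (x + π * Complex.I) : ℂ) =
      ((α - 1) * x : ℝ) + ((π * α : ℝ) * Complex.I - π * Complex.I) by
      push_cast; ring, Complex.exp_add, Complex.exp_sub, Complex.exp_pi_mul_I, Complex.exp_mul_I]
    push_cast; ring
  have e4 : Real.exp (2 * α * x) = Real.exp (α * x) ^ 2 := by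
    rw [← Real.exp_nat_mul]; congr 1; push_cast; ring
  rw [expKernel_of_ne α hne, e1, e2, e3, e4]
  have hcs := Real.sin_sq_add_cos_sq (π * α)
  have hE := Real.exp_pos (α * x)
  generalize Real.sin (π * α) = s at *
  generalize Real.cos (π * α) = c at *
  generalize Real.exp (α * x) = E at *
  generalize Real.exp ((α - 1) * x) = F at *
  generalize Real.exp x = t at *
  have hD : E ^ 2 - 2 * E * c + 1 ≠ 0 := by
    have : 0 < s ^ 2 := by positivity
    nlinarith [sq_nonneg (E - c)]
  have hnorm : Complex.normSq (E * (c + s * Complex.I) - 1) = E ^ 2 - 2 * E * c + 1 := by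
    simp [Complex.normSq_apply]
    linear_combination E ^ 2 * hcs
  rw [Complex.div_im, hnorm]
  simp
  field_simp
  ring

/-- Bound giving the convergence of `expKernel` to `0` at the left end of the strip. -/
theorem norm_expKernel_le {α : ℝ} (h0 : 0 < α) {x : ℝ} (hx : x < 0) (y : ℝ) :
    ‖expKernel α (x + y * Complex.I)‖ ≤
      Real.exp ((α - 1) * x) * (Real.exp x + 1) / (1 - Real.exp (α * x)) := by
  have hne : (x + y * Complex.I : ℂ) ≠ 0 := by
    intro h
    have := congrArg Complex.re h
    simp at this
    exact hx.ne this
  have hlt : Real.exp (α * x) < 1 := by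
    rw [Real.exp_lt_one_iff]; exact mul_neg_of_pos_of_neg h0 hx
  have n1 : ‖Complex.exp ((α - 1) * (x + y * Complex.I))‖ = Real.exp ((α - 1) * x) := by
    simp [Complex.norm_exp]
  have n2 : ‖Complex.exp (x + y * Complex.I)‖ = Real.exp x := by
    simp [Complex.norm_exp]
  have n3 : ‖Complex.exp (α * (x + y * Complex.I))‖ = Real.exp (α * x) := by
    simp [Complex.norm_exp]
  rw [expKernel_of_ne α hne, norm_div, norm_mul, n1]
  have k1 := norm_sub_le (Complex.exp (x + y * Complex.I)) 1
  have k2 := norm_sub_norm_le (1 : ℂ) (Complex.exp (α * (x + y * Complex.I)))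
  rw [norm_one, n2] at k1
  rw [norm_one, n3, norm_sub_rev] at k2
  have : 0 < 1 - Real.exp (α * x) := by linarith
  gcongr

/-- Bound giving the convergence of `expKernel` to `1` at the right end of the strip. -/
theorem norm_expKernel_sub_one_le {α : ℝ} (h0 : 0 < α) {x : ℝ} (hx : 0 < x) (y : ℝ) :
    ‖expKernel α (x + y * Complex.I) - 1‖ ≤
      (Real.exp (-(α * x)) + Real.exp (-x)) / (1 - Real.exp (-(α * x))) := by
  have hne : (x + y * Complex.I : ℂ) ≠ 0 := by
    intro h
    have := congrArg Complex.re h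
    simp at this
    exact hx.ne' this
  have hlt : Real.exp (-(α * x)) < 1 := by
    rw [Real.exp_lt_one_iff]; have := mul_pos h0 hx; linarith
  have n2 : ‖Complex.exp (-(x + y * Complex.I))‖ = Real.exp (-x) := by
    simp [Complex.norm_exp]
  have n3 : ‖Complex.exp (-(α * (x + y * Complex.I)))‖ = Real.exp (-(α * x)) := by
    simp [Complex.norm_exp]
  have k1 := norm_sub_le (Complex.exp (-(α * (x + y * Complex.I))))
    (Complex.exp (-(x + y * Complex.I)))
  have k2 := norm_sub_norm_le (1 : ℂ) (Complex.exp (-(α * (x + y * Complex.I))))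
  rw [n2, n3] at k1
  rw [norm_one, n3] at k2
  rw [expKernel_of_ne α hne]
  generalize (x + y * Complex.I : ℂ) = w at *
  have hpos : 0 < 1 - Real.exp (-(α * x)) := by linarith
  have hd : 1 - Complex.exp (-(α * w)) ≠ 0 := norm_pos_iff.1 (hpos.trans_le k2)
  have ha : Complex.exp (α * w) ≠ 0 := Complex.exp_ne_zero _
  have hb : Complex.exp w ≠ 0 := Complex.exp_ne_zero _
  have hd' : Complex.exp (α * w) - 1 ≠ 0 := by
    intro h
    rw [Complex.exp_neg, sub_eq_zero.1 h] at hd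
    simp at hd
  have key : Complex.exp ((α - 1) * w) * (Complex.exp w - 1) / (Complex.exp (α * w) - 1) - 1 =
      (Complex.exp (-(α * w)) - Complex.exp (-w)) / (1 - Complex.exp (-(α * w))) := by
    rw [sub_one_mul, Complex.exp_sub]
    rw [Complex.exp_neg] at hd ⊢
    rw [Complex.exp_neg]
    rw [div_sub_one hd', div_eq_div_iff hd' hd]
    field_simp
    ring
  rw [key, norm_div]
  gcongr

theorem tendsto_exp_const_mul_atTop_zero {c : ℝ} (hc : c < 0) :
    Tendsto (fun R : ℝ => Real.exp (c * R)) atTop (𝓝 0) :=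
  Real.tendsto_exp_atBot.comp (tendsto_id.const_mul_atTop_of_neg hc)

theorem tendsto_integral_expKernel_left {α : ℝ} (h1 : 1 < α) :
    Tendsto (fun R : ℝ => ∫ y in (0 : ℝ)..π, expKernel α ((-R : ℝ) + y * Complex.I))
      atTop (𝓝 0) := by
  have hb : Tendsto (fun R : ℝ => Real.exp ((α - 1) * -R) * (Real.exp (-R) + 1) /
      (1 - Real.exp (α * -R)) * |π - 0|) atTop (𝓝 (0 * (0 + 1) / (1 - 0) * |π - 0|)) := by
    have t1 := tendsto_exp_const_mul_atTop_zero (c := -(α - 1)) (by linarith)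
    have t2 := tendsto_exp_const_mul_atTop_zero (c := -1) (by norm_num)
    have t3 := tendsto_exp_const_mul_atTop_zero (c := -α) (by linarith)
    simp only [neg_mul, one_mul] at t1 t2 t3
    simp only [mul_neg]
    exact ((t1.mul (t2.add_const 1)).div (t3.const_sub 1) (by norm_num)).mul_const _
  rw [zero_mul, zero_div, zero_mul] at hb
  refine squeeze_zero_norm' ?_ hb
  filter_upwards [eventually_gt_atTop 0] with R hR
  exact intervalIntegral.norm_integral_le_of_norm_le_const
    fun y _ => norm_expKernel_le (by linarith) (by linarith) y

theorem intervalIntegrable_expKernel_vertical {α : ℝ} (h0 : 0 < α) (h2 : α < 2) (x : ℝ) :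
    IntervalIntegrable (fun y : ℝ => expKernel α (x + y * Complex.I)) volume 0 π := by
  refine ContinuousOn.intervalIntegrable ?_
  refine (differentiableOn_expKernel h0 h2).continuousOn.comp (by fun_prop) ?_
  intro y hy
  rw [uIcc_of_le Real.pi_pos.le] at hy
  simpa using hy

theorem tendsto_integral_expKernel_right {α : ℝ} (h1 : 1 < α) (h2 : α < 2) :
    Tendsto (fun R : ℝ => ∫ y in (0 : ℝ)..π, expKernel α (R + y * Complex.I))
      atTop (𝓝 π) := by
  have hb : Tendsto (fun R : ℝ => (Real.exp (-(α * R)) + Real.exp (-R)) /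
      (1 - Real.exp (-(α * R))) * |π - 0|) atTop (𝓝 ((0 + 0) / (1 - 0) * |π - 0|)) := by
    have t2 := tendsto_exp_const_mul_atTop_zero (c := -1) (by norm_num)
    have t3 := tendsto_exp_const_mul_atTop_zero (c := -α) (by linarith)
    simp only [neg_mul, one_mul] at t2 t3
    exact ((t3.add t2).div (t3.const_sub 1) (by norm_num)).mul_const _
  rw [add_zero, zero_div, zero_mul] at hb
  rw [tendsto_iff_norm_sub_tendsto_zero]
  refine squeeze_zero' (Eventually.of_forall fun _ => norm_nonneg _) ?_ hb
  filter_upwards [eventually_gt_atTop 0] with R hR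
  have : (∫ y in (0 : ℝ)..π, expKernel α (R + y * Complex.I)) - π =
      ∫ y in (0 : ℝ)..π, (expKernel α (R + y * Complex.I) - 1) := by
    rw [intervalIntegral.integral_sub
      (intervalIntegrable_expKernel_vertical (by linarith) h2 R) (by simp)]
    simp
  rw [this]
  exact intervalIntegral.norm_integral_le_of_norm_le_const
    fun y _ => norm_expKernel_sub_one_le (by linarith) hR y

theorem continuous_expKernel_horizontal {α : ℝ} (h0 : 0 < α) (h2 : α < 2) {y : ℝ}
    (hy : y ∈ Icc 0 π) : Continuous fun x : ℝ => expKernel α (x + y * Complex.I) := by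
  rw [← continuousOn_univ]
  refine (differentiableOn_expKernel h0 h2).continuousOn.comp (by fun_prop) ?_
  intro x _
  simpa using hy

theorem intervalIntegral_im {f : ℝ → ℂ} (hf : Continuous f) (a b : ℝ) :
    (∫ x in a..b, f x).im = ∫ x in a..b, (f x).im :=
  (Complex.imCLM.intervalIntegral_comp_comm (hf.intervalIntegrable a b)).symm

theorem tendsto_integral_expKernel_add_pi_im {α : ℝ} (h1 : 1 < α) (h2 : α < 2) :
    Tendsto (fun R : ℝ => ∫ x in (-R)..R, (expKernel α (x + π * Complex.I)).im)
      atTop (𝓝 π) := by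
  have h0 : 0 < α := by linarith
  have hl := (Complex.continuous_re.tendsto _).comp (tendsto_integral_expKernel_left h1)
  have hr := (Complex.continuous_re.tendsto _).comp (tendsto_integral_expKernel_right h1 h2)
  have := hr.sub hl
  rw [Complex.ofReal_re, Complex.zero_re, sub_zero] at this
  refine this.congr fun R => ?_
  have hrect := Complex.integral_boundary_rect_eq_zero_of_differentiableOn (expKernel α)
    ((-R : ℝ) : ℂ) (R + π * Complex.I) ((differentiableOn_expKernel h0 h2).mono ?_)
  · have him := congrArg Complex.im hrect
    have hbot := intervalIntegral_im
      (continuous_expKernel_horizontal h0 h2 (left_mem_Icc.2 Real.pi_pos.le)) (-R) R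
    have htop := intervalIntegral_im
      (continuous_expKernel_horizontal h0 h2 (right_mem_Icc.2 Real.pi_pos.le)) (-R) R
    simp only [Complex.ofReal_zero, zero_mul, add_zero, expKernel_ofReal_im,
      intervalIntegral.integral_zero] at hbot
    simp [-Complex.ofReal_neg, hbot] at him
    simp only [Function.comp_apply]
    rw [← htop]
    linarith
  · intro w hw
    have := hw.2
    simpa [uIcc_of_le Real.pi_pos.le] using this

theorem stmt0 (α : ℝ) (hα : α ∈ Ioo (1:ℝ) 2)
    (v : ℝ → ℝ)
    (hv : ∀ t : ℝ, v t =
      (-Real.sin (π * α)) * t ^ (α - 2) * (1 + t) /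
        (π * (t ^ (2 * α) - 2 * t ^ α * Real.cos (π * α) + 1))) :
    (∀ t ∈ Ioi (0:ℝ), 0 ≤ v t) ∧ ∫ t in Ioi (0:ℝ), v t = 1 := by
  obtain ⟨h1, h2⟩ := hα
  have hp := Real.pi_pos
  have hsin : Real.sin (π * α) < 0 := by
    have := Real.sin_pos_of_pos_of_lt_pi (x := π * α - π) (by nlinarith) (by nlinarith)
    rw [Real.sin_sub_pi] at this
    linarith
  have hnonneg : ∀ t ∈ Ioi (0:ℝ), 0 ≤ v t := by
    intro t ht
    have ht' : (0:ℝ) < t := ht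
    have hsq : t ^ (2 * α) = (t ^ α) ^ 2 := by
      rw [← Real.rpow_natCast, ← Real.rpow_mul ht'.le, mul_comm]; norm_num
    rw [hv, hsq]
    have hD : 0 ≤ (t ^ α) ^ 2 - 2 * t ^ α * Real.cos (π * α) + 1 := by
      nlinarith [sq_nonneg (t ^ α - Real.cos (π * α)), Real.sin_sq_add_cos_sq (π * α),
        sq_nonneg (Real.sin (π * α))]
    have : 0 < -Real.sin (π * α) := by linarith
    positivity
  refine ⟨hnonneg, ?_⟩
  have hcv : ∀ x : ℝ, Real.exp x * v (Real.exp x) =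
      (expKernel α (x + π * Complex.I)).im / π := by
    intro x
    rw [expKernel_add_pi_im hsin.ne, hv, ← Real.exp_mul, ← Real.exp_mul, ← Real.exp_mul,
      show (α - 1) * x = x + x * (α - 2) by ring, Real.exp_add, mul_comm x (2 * α), mul_comm x α,
      div_div, mul_comm π]
    ring
  have hcont : Continuous fun x : ℝ => Real.exp x * v (Real.exp x) := by
    simp only [hcv]
    exact (Complex.continuous_im.comp (continuous_expKernel_horizontal (by linarith) h2
      (right_mem_Icc.2 hp.le))).div_const _
  have hlim : Tendsto (fun R : ℝ => ∫ x in (-R)..R, Real.exp x * v (Real.exp x))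
      atTop (𝓝 1) := by
    simp only [hcv, intervalIntegral.integral_div]
    simpa [hp.ne'] using (tendsto_integral_expKernel_add_pi_im h1 h2).div_const π
  have hint : Integrable fun x : ℝ => Real.exp x * v (Real.exp x) := by
    refine integrable_of_intervalIntegral_norm_tendsto 1
      (fun R => hcont.integrableOn_Ioc) tendsto_neg_atTop_atBot tendsto_id (hlim.congr fun R => ?_)
    refine intervalIntegral.integral_congr fun x _ => ?_
    exact (Real.norm_of_nonneg
      (mul_nonneg (Real.exp_pos x).le (hnonneg _ (Real.exp_pos x)))).symm
  have hsub := integral_image_eq_integral_abs_deriv_smul MeasurableSet.univ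
    (fun x _ => (Real.hasDerivAt_exp x).hasDerivWithinAt) Real.exp_injective.injOn v
  rw [image_univ, Real.range_exp] at hsub
  simp only [Real.abs_exp, smul_eq_mul, Measure.restrict_univ] at hsub
  rw [hsub]
  exact tendsto_nhds_unique
    (intervalIntegral_tendsto_integral hint tendsto_neg_atTop_atBot tendsto_id) hlim
end

section
/- For every α ∈ (1,2), the function t ↦ (-sin(πα))(1 + t^{1/α}) / (πα(t² - 2t cos(πα) + 1)) is a probability density on (0,∞). -/
open Real MeasureTheory Set

open Filter Topology in
/-- For `0 < θ < π`, `∫₀^∞ sin θ / (t² + 2 t cos θ + 1) dt = θ`. -/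
lemma integral_Ioi_sin_div_quadratic {θ : ℝ} (h0 : 0 < θ) (hπ : θ < π) :
    IntegrableOn (fun t : ℝ => sin θ / (t ^ 2 + 2 * t * cos θ + 1)) (Ioi 0) ∧
      ∫ t in Ioi (0 : ℝ), sin θ / (t ^ 2 + 2 * t * cos θ + 1) = θ := by
  have hs : 0 < sin θ := sin_pos_of_pos_of_lt_pi h0 hπ
  have hsc : sin θ ^ 2 + cos θ ^ 2 = 1 := sin_sq_add_cos_sq θ
  have hq : ∀ t : ℝ, 0 < t ^ 2 + 2 * t * cos θ + 1 := fun t => by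
    nlinarith [sq_nonneg (t + cos θ), pow_pos hs 2]
  have hd : ∀ t ∈ Ici (0 : ℝ), HasDerivAt (fun t : ℝ => arctan ((t + cos θ) / sin θ))
      (sin θ / (t ^ 2 + 2 * t * cos θ + 1)) t := fun t _ => by
    have h := (((hasDerivAt_id t).add_const (cos θ)).div_const (sin θ)).arctan
    refine h.congr_deriv ?_
    have h1 : 1 + ((t + cos θ) / sin θ) ^ 2 = (t ^ 2 + 2 * t * cos θ + 1) / sin θ ^ 2 := by
      field_simp
      linear_combination hsc
    have := (hq t).ne'
    simp only [id, h1]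
    field_simp
  have hpos : ∀ t ∈ Ioi (0 : ℝ), 0 ≤ sin θ / (t ^ 2 + 2 * t * cos θ + 1) := fun t _ =>
    (div_pos hs (hq t)).le
  have hlim : Tendsto (fun t : ℝ => arctan ((t + cos θ) / sin θ)) atTop (𝓝 (π / 2)) :=
    (tendsto_arctan_atTop.mono_right nhdsWithin_le_nhds).comp
      ((tendsto_atTop_add_const_right _ _ tendsto_id).atTop_div_const hs)
  have harc : arctan ((0 + cos θ) / sin θ) = π / 2 - θ := by
    refine arctan_eq_of_tan_eq ?_ ⟨by linarith, by linarith⟩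
    rw [tan_pi_div_two_sub, tan_eq_sin_div_cos, inv_div, zero_add]
  refine ⟨integrableOn_Ioi_deriv_of_nonneg' hd hpos hlim, ?_⟩
  rw [integral_Ioi_of_hasDerivAt_of_nonneg' hd hpos hlim, harc]
  ring

lemma image_div_one_add_Ioi : (fun t : ℝ => t / (1 + t)) '' Ioi 0 = Ioo 0 1 := by
  ext x
  constructor
  · rintro ⟨t, ht, rfl⟩
    have ht : 0 < t := ht
    exact ⟨by positivity, (div_lt_one (by positivity)).2 (by linarith)⟩
  · rintro ⟨h0, h1⟩
    have h : 0 < 1 - x := by linarith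
    refine ⟨x / (1 - x), div_pos h0 h, ?_⟩
    field_simp
    ring

/-- The Mellin transform of `1 / (1 + t)`, from Euler's reflection formula. -/
lemma integral_Ioi_rpow_div_one_add {s : ℝ} (h0 : 0 < s) (h1 : s < 1) :
    IntegrableOn (fun t : ℝ => t ^ (s - 1) / (1 + t)) (Ioi 0) ∧
      ∫ t in Ioi (0 : ℝ), t ^ (s - 1) / (1 + t) = π / sin (π * s) := by
  set b : ℝ → ℂ := fun x => (x : ℂ) ^ ((s : ℂ) - 1) * (1 - (x : ℂ)) ^ ((1 - s : ℂ) - 1)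
  have hu : 0 < (s : ℂ).re := by simpa
  have hv : 0 < (1 - s : ℂ).re := by simpa
  have hb : IntegrableOn b (Ioo 0 1) := by
    rw [← intervalIntegrable_iff_integrableOn_Ioo_of_le zero_le_one]
    exact Complex.betaIntegral_convergent hu hv
  have hb' : ∫ x in Ioo (0 : ℝ) 1, b x = π / Complex.sin (π * s) := by
    have := Complex.Gamma_mul_Gamma_eq_betaIntegral hu hv
    rw [add_sub_cancel, Complex.Gamma_one, one_mul, Complex.Gamma_mul_Gamma_one_sub,
      Complex.betaIntegral, intervalIntegral.integral_of_le zero_le_one,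
      integral_Ioc_eq_integral_Ioo] at this
    exact this.symm
  have hd : ∀ t ∈ Ioi (0 : ℝ),
      HasDerivWithinAt (fun t : ℝ => t / (1 + t)) (1 / (1 + t) ^ 2) (Ioi 0) t := fun t ht => by
    have ht : 0 < t := ht
    have h := (hasDerivAt_id t).div ((hasDerivAt_id t).const_add 1)
      (show (1 : ℝ) + t ≠ 0 by positivity)
    refine (h.congr_deriv ?_).hasDerivWithinAt
    simp
  have hinj : InjOn (fun t : ℝ => t / (1 + t)) (Ioi 0) := fun x hx y hy hxy => by
    have hx : 0 < x := hx
    have hy : 0 < y := hy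
    simp only at hxy
    rw [div_eq_div_iff (by positivity) (by positivity)] at hxy
    linarith
  have hcongr : EqOn (fun t : ℝ => |1 / (1 + t) ^ 2| • b (t / (1 + t)))
      (fun t => ((t ^ (s - 1) / (1 + t) : ℝ) : ℂ)) (Ioi 0) := fun t ht => by
    have ht : 0 < t := ht
    have h1t : 0 < 1 + t := by positivity
    have hsub : 1 - t / (1 + t) = (1 + t)⁻¹ := by field_simp; ring
    have hbt : b (t / (1 + t)) =
        (((t / (1 + t)) ^ (s - 1) * (1 - t / (1 + t)) ^ (1 - s - 1) : ℝ) : ℂ) := by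
      rw [Complex.ofReal_mul, Complex.ofReal_cpow (by positivity),
        Complex.ofReal_cpow (by rw [hsub]; positivity)]
      simp [b]
    simp only [hbt]
    rw [Complex.real_smul, ← Complex.ofReal_mul]
    congr 1
    rw [hsub, abs_of_pos (by positivity), div_rpow ht.le h1t.le, inv_rpow h1t.le,
      ← rpow_neg h1t.le, show -(1 - s - 1) = (s - 1) + 1 by ring, rpow_add h1t, rpow_one]
    have := (rpow_pos_of_pos h1t (s - 1)).ne'
    field_simp
  have hint : IntegrableOn (fun t : ℝ => ((t ^ (s - 1) / (1 + t) : ℝ) : ℂ)) (Ioi 0) := by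
    rw [← integrableOn_congr_fun hcongr measurableSet_Ioi,
      ← integrableOn_image_iff_integrableOn_abs_deriv_smul measurableSet_Ioi hd hinj,
      image_div_one_add_Ioi]
    exact hb
  refine ⟨hint.re, ?_⟩
  have := integral_image_eq_integral_abs_deriv_smul measurableSet_Ioi hd hinj b
  rw [image_div_one_add_Ioi, hb', setIntegral_congr_fun measurableSet_Ioi hcongr,
    integral_complex_ofReal] at this
  exact_mod_cast this.symm

lemma normSq_one_add_mul_exp_mul_I (θ t : ℝ) :
    Complex.normSq (1 + t * Complex.exp (θ * Complex.I)) = t ^ 2 + 2 * t * cos θ + 1 := by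
  rw [Complex.normSq_apply, Complex.exp_mul_I, ← Complex.ofReal_cos, ← Complex.ofReal_sin]
  simp [-Complex.ofReal_cos, -Complex.ofReal_sin]
  linear_combination t ^ 2 * sin_sq_add_cos_sq θ

lemma mul_one_add_le_norm_one_add_mul_exp {c θ t : ℝ} (hc : 0 ≤ c) (hcθ : c ≤ cos (θ / 2)) :
    c * (1 + t) ≤ ‖1 + t * Complex.exp (θ * Complex.I)‖ := by
  refine le_of_abs_le (abs_le_of_sq_le_sq ?_ (norm_nonneg _))
  rw [← Complex.normSq_eq_norm_sq, normSq_one_add_mul_exp_mul_I]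
  have h2 : cos θ = 2 * cos (θ / 2) ^ 2 - 1 := by rw [← cos_two_mul]; ring_nf
  have h3 : c ^ 2 ≤ cos (θ / 2) ^ 2 := by gcongr
  rw [h2]
  nlinarith [mul_nonneg (sub_nonneg.2 (cos_sq_le_one (θ / 2))) (sq_nonneg (1 - t)),
    mul_nonneg (sub_nonneg.2 h3) (sq_nonneg (1 + t))]

lemma one_add_mul_exp_ne_zero {θ t : ℝ} (hθ : θ ∈ Ioo (-π) π) (ht : 0 ≤ t) :
    1 + t * Complex.exp (θ * Complex.I) ≠ 0 := by
  have hc : 0 < cos (θ / 2) := cos_pos_of_mem_Ioo ⟨by linarith [hθ.1], by linarith [hθ.2]⟩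
  exact norm_pos_iff.1 <|
    (mul_pos hc (by linarith)).trans_le (mul_one_add_le_norm_one_add_mul_exp hc.le le_rfl)

lemma norm_rpow_div_le {c r t : ℝ} {z : ℂ} (hc : 0 < c) (ht : 0 < t) (hz : c * (1 + t) ≤ ‖z‖) :
    ‖((t ^ r : ℝ) : ℂ) / z‖ ≤ c⁻¹ * (t ^ r / (1 + t)) := by
  rw [norm_div, Complex.norm_of_nonneg (by positivity)]
  calc t ^ r / ‖z‖ ≤ t ^ r / (c * (1 + t)) := by gcongr
    _ = c⁻¹ * (t ^ r / (1 + t)) := by field_simp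

lemma aestronglyMeasurable_rpow_div {θ : ℝ} (r : ℝ) (n : ℕ) :
    AEStronglyMeasurable (fun t : ℝ => ((t ^ r : ℝ) : ℂ) /
      (1 + t * Complex.exp (θ * Complex.I)) ^ n) (volume.restrict (Ioi 0)) := by
  apply Measurable.aestronglyMeasurable
  fun_prop

lemma integrableOn_rpow_div_one_add_mul_exp {s θ : ℝ} (h0 : 0 < s) (h1 : s < 1)
    (hθ : θ ∈ Ioo (-π) π) :
    IntegrableOn (fun t : ℝ => ((t ^ (s - 1) : ℝ) : ℂ) / (1 + t * Complex.exp (θ * Complex.I)))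
      (Ioi 0) := by
  have hc : 0 < cos (θ / 2) := cos_pos_of_mem_Ioo ⟨by linarith [hθ.1], by linarith [hθ.2]⟩
  refine ((integral_Ioi_rpow_div_one_add h0 h1).1.const_mul (cos (θ / 2))⁻¹).mono'
    (by simpa using aestronglyMeasurable_rpow_div (θ := θ) (s - 1) 1) ?_
  filter_upwards [ae_restrict_mem measurableSet_Ioi] with t ht
  exact norm_rpow_div_le hc ht (mul_one_add_le_norm_one_add_mul_exp hc.le le_rfl)

open Filter Topology in
/-- Integrating the derivative of `t ^ s / (1 + t e ^ (iθ))` over `(0, ∞)`. -/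
lemma integral_rpow_mul_exp_div_sq {s θ : ℝ} (h0 : 0 < s) (h1 : s < 1) (hθ : θ ∈ Ioo (-π) π)
    (hint : IntegrableOn (fun t : ℝ => ((t ^ s : ℝ) : ℂ) * Complex.exp (θ * Complex.I) /
      (1 + t * Complex.exp (θ * Complex.I)) ^ 2) (Ioi 0)) :
    ∫ t in Ioi (0 : ℝ), ((t ^ s : ℝ) : ℂ) * Complex.exp (θ * Complex.I) /
        (1 + t * Complex.exp (θ * Complex.I)) ^ 2 =
      s * ∫ t in Ioi (0 : ℝ), ((t ^ (s - 1) : ℝ) : ℂ) /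
        (1 + t * Complex.exp (θ * Complex.I)) := by
  set w := Complex.exp (θ * Complex.I)
  have hc : 0 < cos (θ / 2) := cos_pos_of_mem_Ioo ⟨by linarith [hθ.1], by linarith [hθ.2]⟩
  have hG := integrableOn_rpow_div_one_add_mul_exp h0 h1 hθ
  have hcont : ContinuousWithinAt (fun t : ℝ => ((t ^ s : ℝ) : ℂ) / (1 + t * w)) (Ici 0) 0 := by
    refine ContinuousAt.continuousWithinAt (ContinuousAt.div ?_ (by fun_prop) (by simp))
    exact Complex.continuous_ofReal.continuousAt.comp
      (continuousAt_rpow_const _ _ (Or.inr h0.le))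
  have hd : ∀ t ∈ Ioi (0 : ℝ), HasDerivAt (fun t : ℝ => ((t ^ s : ℝ) : ℂ) / (1 + t * w))
      (s * (((t ^ (s - 1) : ℝ) : ℂ) / (1 + t * w)) -
        ((t ^ s : ℝ) : ℂ) * w / (1 + t * w) ^ 2) t := fun t ht => by
    have hne : 1 + t * w ≠ 0 := one_add_mul_exp_ne_zero hθ (le_of_lt ht)
    have hnum := (hasDerivAt_rpow_const (p := s) (Or.inl (ne_of_gt ht))).ofReal_comp
    have hden := (((hasDerivAt_id t).ofReal_comp).mul_const w).const_add 1
    refine (hnum.div hden hne).congr_deriv ?_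
    simp only [id, Complex.ofReal_mul, Complex.ofReal_one]
    field_simp
  have hlim : Tendsto (fun t : ℝ => ((t ^ s : ℝ) : ℂ) / (1 + t * w)) atTop (𝓝 0) := by
    have hz : Tendsto (fun t : ℝ => (cos (θ / 2))⁻¹ * t ^ (s - 1)) atTop (𝓝 0) := by
      simpa using (tendsto_rpow_neg_atTop (show 0 < 1 - s by linarith)).const_mul (cos (θ / 2))⁻¹
    refine squeeze_zero_norm' ?_ hz
    filter_upwards [eventually_gt_atTop 0] with t ht
    refine (norm_rpow_div_le hc ht
      (mul_one_add_le_norm_one_add_mul_exp hc.le le_rfl)).trans ?_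
    rw [rpow_sub_one ht.ne']
    gcongr
    linarith
  have h := integral_Ioi_of_hasDerivAt_of_tendsto hcont hd ((hG.const_mul _).sub hint) hlim
  rw [integral_sub (hG.const_mul _) hint, integral_const_mul] at h
  simp only [zero_rpow h0.ne', Complex.ofReal_zero, zero_div, sub_zero] at h
  exact (sub_eq_zero.1 h).symm

open Topology in
lemma hasDerivAt_integral_rpow_div_one_add_mul_exp {s θ : ℝ} (h0 : 0 < s) (h1 : s < 1)
    (hθ : θ ∈ Ioo (-π) π) :
    HasDerivAt (fun φ : ℝ => ∫ t in Ioi (0 : ℝ), ((t ^ (s - 1) : ℝ) : ℂ) /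
        (1 + t * Complex.exp (φ * Complex.I)))
      (-(Complex.I * s) * ∫ t in Ioi (0 : ℝ), ((t ^ (s - 1) : ℝ) : ℂ) /
        (1 + t * Complex.exp (θ * Complex.I))) θ := by
  have hc : 0 < cos (θ / 2) := cos_pos_of_mem_Ioo ⟨by linarith [hθ.1], by linarith [hθ.2]⟩
  obtain ⟨c, hc0, hcθ⟩ := exists_between hc
  have hU : {φ : ℝ | c < cos (φ / 2)} ∈ 𝓝 θ :=
    (isOpen_lt continuous_const (by fun_prop)).mem_nhds hcθ
  have key := hasDerivAt_integral_of_dominated_loc_of_deriv_le (𝕜 := ℝ)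
    (μ := volume.restrict (Ioi (0 : ℝ)))
    (F := fun φ t => ((t ^ (s - 1) : ℝ) : ℂ) / (1 + t * Complex.exp (φ * Complex.I)))
    (F' := fun φ t => -Complex.I * (((t ^ s : ℝ) : ℂ) * Complex.exp (φ * Complex.I) /
      (1 + t * Complex.exp (φ * Complex.I)) ^ 2))
    (bound := fun t => (c ^ 2)⁻¹ * (t ^ (s - 1) / (1 + t))) hU
    (Filter.Eventually.of_forall fun φ => by
      simpa using aestronglyMeasurable_rpow_div (θ := φ) (s - 1) 1)
    (integrableOn_rpow_div_one_add_mul_exp h0 h1 hθ)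
    (Measurable.aestronglyMeasurable (by fun_prop)) ?_
    ((integral_Ioi_rpow_div_one_add h0 h1).1.const_mul _) ?_
  · have hint : IntegrableOn (fun t : ℝ => ((t ^ s : ℝ) : ℂ) * Complex.exp (θ * Complex.I) /
        (1 + t * Complex.exp (θ * Complex.I)) ^ 2) (Ioi 0) :=
      (integrable_const_mul_iff (by simp) _).1 key.1
    refine key.2.congr_deriv ?_
    rw [integral_const_mul, integral_rpow_mul_exp_div_sq h0 h1 hθ hint]
    ring
  · filter_upwards [ae_restrict_mem measurableSet_Ioi] with t ht φ hφ
    have ht : 0 < t := ht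
    have hle := mul_one_add_le_norm_one_add_mul_exp (t := t) hc0.le (le_of_lt hφ)
    rw [norm_mul, norm_neg, Complex.norm_I, one_mul, norm_div, norm_mul, norm_pow,
      Complex.norm_exp_ofReal_mul_I, mul_one, Complex.norm_of_nonneg (by positivity)]
    calc t ^ s / ‖1 + t * Complex.exp (φ * Complex.I)‖ ^ 2
        ≤ t ^ s / (c * (1 + t)) ^ 2 := by gcongr
      _ = (c ^ 2)⁻¹ * (t ^ (s - 1) / (1 + t)) * (t / (1 + t)) := by
        rw [rpow_sub_one ht.ne']
        field_simp
      _ ≤ (c ^ 2)⁻¹ * (t ^ (s - 1) / (1 + t)) := by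
        refine mul_le_of_le_one_right (by positivity) ?_
        exact (div_le_one (by positivity)).2 (by linarith)
  · filter_upwards [ae_restrict_mem measurableSet_Ioi] with t ht φ hφ
    have ht : 0 < t := ht
    have hne : 1 + t * Complex.exp (φ * Complex.I) ≠ 0 := norm_pos_iff.1 <|
      (mul_pos hc0 (by linarith)).trans_le
        (mul_one_add_le_norm_one_add_mul_exp hc0.le (le_of_lt hφ))
    have hden := (((((hasDerivAt_id φ).ofReal_comp).mul_const Complex.I).cexp).const_mul
      (t : ℂ)).const_add 1
    refine ((hasDerivAt_const φ ((t ^ (s - 1) : ℝ) : ℂ)).div hden hne).congr_deriv ?_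
    rw [rpow_sub_one ht.ne']
    have : (t : ℂ) ≠ 0 := by exact_mod_cast ht.ne'
    simp only [id, Complex.ofReal_div, Complex.ofReal_one]
    field_simp
    ring

lemma integral_rpow_div_one_add_mul_exp {s θ : ℝ} (h0 : 0 < s) (h1 : s < 1)
    (hθ : θ ∈ Ioo (-π) π) :
    ∫ t in Ioi (0 : ℝ), ((t ^ (s - 1) : ℝ) : ℂ) / (1 + t * Complex.exp (θ * Complex.I)) =
      Complex.exp (-(s * θ : ℝ) * Complex.I) * (π / sin (π * s) : ℝ) := by
  set G : ℝ → ℂ := fun φ => ∫ t in Ioi (0 : ℝ), ((t ^ (s - 1) : ℝ) : ℂ) /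
    (1 + t * Complex.exp (φ * Complex.I))
  have hd : ∀ φ ∈ Ioo (-π) π,
      HasDerivAt (fun φ : ℝ => Complex.exp (s * φ * Complex.I) * G φ) 0 φ := fun φ hφ => by
    have he := ((((hasDerivAt_id φ).ofReal_comp).const_mul (s : ℂ)).mul_const Complex.I).cexp
    refine (he.mul (hasDerivAt_integral_rpow_div_one_add_mul_exp h0 h1 hφ)).congr_deriv ?_
    simp only [id, Complex.ofReal_one]
    ring
  have hG0 : G 0 = (π / sin (π * s) : ℝ) := by
    rw [← (integral_Ioi_rpow_div_one_add h0 h1).2, ← integral_complex_ofReal]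
    simp [G]
  have hconst := isOpen_Ioo.is_const_of_deriv_eq_zero isPreconnected_Ioo
    (fun φ hφ => (hd φ hφ).differentiableAt.differentiableWithinAt)
    (fun φ hφ => (hd φ hφ).deriv) hθ (show (0 : ℝ) ∈ Ioo (-π) π by simp [pi_pos])
  simp only [Complex.ofReal_zero, mul_zero, zero_mul, Complex.exp_zero, one_mul, hG0] at hconst
  rw [← hconst, ← mul_assoc, ← Complex.exp_add]
  simp [G]

/-- For `0 < s < 1` and `-π < θ < π`,
`∫₀^∞ t ^ s sin θ / (t² + 2 t cos θ + 1) dt = π sin (s θ) / sin (π s)`. -/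
lemma integral_Ioi_rpow_mul_sin_div_quadratic {s θ : ℝ} (h0 : 0 < s) (h1 : s < 1)
    (hθ : θ ∈ Ioo (-π) π) :
    IntegrableOn (fun t : ℝ => t ^ s * sin θ / (t ^ 2 + 2 * t * cos θ + 1)) (Ioi 0) ∧
      ∫ t in Ioi (0 : ℝ), t ^ s * sin θ / (t ^ 2 + 2 * t * cos θ + 1) =
        π * sin (s * θ) / sin (π * s) := by
  have hG := integrableOn_rpow_div_one_add_mul_exp h0 h1 hθ
  have him : EqOn (fun t : ℝ => -(((t ^ (s - 1) : ℝ) : ℂ) /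
      (1 + t * Complex.exp (θ * Complex.I))).im)
      (fun t => t ^ s * sin θ / (t ^ 2 + 2 * t * cos θ + 1)) (Ioi 0) := fun t ht => by
    have ht : 0 < t := ht
    have h : (1 + t * Complex.exp (θ * Complex.I)).im = t * sin θ := by
      simp [Complex.exp_ofReal_mul_I_im]
    simp only [Complex.div_im, Complex.ofReal_im, Complex.ofReal_re,
      normSq_one_add_mul_exp_mul_I, h]
    rw [rpow_sub_one ht.ne']
    field_simp
    ring
  refine ⟨(integrableOn_congr_fun him measurableSet_Ioi).1 hG.im.neg, ?_⟩
  have hval := congrArg Complex.im (integral_rpow_div_one_add_mul_exp h0 h1 hθ)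
  rw [← setIntegral_congr_fun measurableSet_Ioi him, integral_neg]
  have := integral_im hG
  simp only [RCLike.im_to_complex] at this
  rw [this, hval, Complex.im_mul_ofReal, ← Complex.ofReal_neg, Complex.exp_ofReal_mul_I_im,
    sin_neg]
  ring

theorem stmt1 (α : ℝ) (hα : α ∈ Ioo (1:ℝ) 2)
    (g : ℝ → ℝ)
    (hg : ∀ t : ℝ, g t =
      (-Real.sin (π * α)) * (1 + t ^ (1/α)) /
        (π * α * (t ^ 2 - 2 * t * Real.cos (π * α) + 1))) :
    (∀ t ∈ Ioi (0:ℝ), 0 ≤ g t) ∧ ∫ t in Ioi (0:ℝ), g t = 1 := by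
  obtain ⟨h1, h2⟩ := hα
  have hα0 : 0 < α := by linarith
  have hπ := pi_pos
  set θ := π * α - π with hθdef
  have hθ0 : 0 < θ := by nlinarith
  have hθπ : θ < π := by nlinarith
  have hsin : sin θ = -sin (π * α) := sin_sub_pi _
  have hcos : cos θ = -cos (π * α) := cos_sub_pi _
  have hs0 : 0 < 1 / α := by positivity
  have hs1 : 1 / α < 1 := (div_lt_one hα0).2 h1
  have hsinθ : 0 < sin θ := sin_pos_of_pos_of_lt_pi hθ0 hθπ
  have hg' : ∀ t, g t = (π * α)⁻¹ * (sin θ / (t ^ 2 + 2 * t * cos θ + 1) +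
      t ^ (1 / α) * sin θ / (t ^ 2 + 2 * t * cos θ + 1)) := fun t => by
    rw [hg, ← hsin, show cos (π * α) = -cos θ by rw [hcos, neg_neg], ← add_div,
      ← div_eq_inv_mul, div_div]
    ring_nf
  obtain ⟨hA, hA'⟩ := integral_Ioi_sin_div_quadratic hθ0 hθπ
  obtain ⟨hB, hB'⟩ := integral_Ioi_rpow_mul_sin_div_quadratic hs0 hs1
    (show θ ∈ Ioo (-π) π from ⟨by linarith, hθπ⟩)
  refine ⟨fun t ht => ?_, ?_⟩
  · have ht : 0 < t := ht
    have hq : 0 < t ^ 2 + 2 * t * cos θ + 1 := by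
      nlinarith [sq_nonneg (t + cos θ), pow_pos hsinθ 2, sin_sq_add_cos_sq θ]
    rw [hg']
    positivity
  · have harg : sin (1 / α * θ) = sin (π * (1 / α)) := by
      rw [← sin_pi_sub]
      congr 1
      rw [hθdef]
      field_simp
      ring
    have hne : sin (π * (1 / α)) ≠ 0 :=
      (sin_pos_of_pos_of_lt_pi (by positivity) (by nlinarith)).ne'
    simp_rw [hg']
    rw [integral_const_mul, integral_add hA hB, hA', hB', harg, mul_div_cancel_right₀ _ hne,
      hθdef, sub_add_cancel, inv_mul_cancel₀ (by positivity)]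
end

section
/- Let α ∈ (1,2). For every λ ≥ 0, the integral ∫₁^∞ (y^{-λ} - 1 + λ(y-1)) / (Γ(-α)(y-1)^{1+α}) dy converges and equals Γ(λ+α)/Γ(λ), where the right-hand side is interpreted as 0 when λ = 0. -/
open Real MeasureTheory Set

open Filter Topology

/-- The Beta integral in the form `∫₀^∞ x^(a-1) (1+x)^(-(a+b)) dx`, as a lower integral. -/
theorem lintegral_rpow_mul_one_add_rpow {a b : ℝ} (ha : 0 < a) (hb : 0 < b) :
    ∫⁻ x in Ioi (0:ℝ), ENNReal.ofReal (x ^ (a - 1) * (1 + x) ^ (-(a + b))) =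
      ENNReal.ofReal (Real.Gamma a * Real.Gamma b / Real.Gamma (a + b)) := by
  have hab : 0 < a + b := add_pos ha hb
  have hG {s r : ℝ} (hs : 0 < s) (hr : 0 < r) :
      ∫⁻ t in Ioi (0:ℝ), ENNReal.ofReal (t ^ (s - 1) * rexp (-(r * t))) =
        ENNReal.ofReal (r ^ (-s) * Real.Gamma s) := by
    have h := Real.integral_rpow_mul_exp_neg_mul_Ioi hs hr
    rw [one_div, inv_rpow hr.le, ← rpow_neg hr.le] at h
    rw [← h, ofReal_integral_eq_lintegral_ofReal]
    · refine Integrable.of_integral_ne_zero ?_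
      rw [h]
      exact (mul_pos (rpow_pos_of_pos hr _) (Gamma_pos_of_pos hs)).ne'
    · filter_upwards [ae_restrict_mem measurableSet_Ioi] with t (ht : 0 < t)
      simp only [Pi.zero_apply]
      positivity
  have key : ∫⁻ x in Ioi (0:ℝ), ∫⁻ t in Ioi (0:ℝ),
        ENNReal.ofReal (x ^ (a - 1) * t ^ (a + b - 1) * rexp (-((1 + x) * t))) =
      ∫⁻ t in Ioi (0:ℝ), ∫⁻ x in Ioi (0:ℝ),
        ENNReal.ofReal (x ^ (a - 1) * t ^ (a + b - 1) * rexp (-((1 + x) * t))) := by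
    refine lintegral_lintegral_swap (Measurable.aemeasurable ?_)
    unfold Function.uncurry
    fun_prop
  have hL : ∫⁻ x in Ioi (0:ℝ), ∫⁻ t in Ioi (0:ℝ),
        ENNReal.ofReal (x ^ (a - 1) * t ^ (a + b - 1) * rexp (-((1 + x) * t))) =
      ENNReal.ofReal (Real.Gamma (a + b)) *
        ∫⁻ x in Ioi (0:ℝ), ENNReal.ofReal (x ^ (a - 1) * (1 + x) ^ (-(a + b))) := by
    rw [← lintegral_const_mul' _ _ ENNReal.ofReal_ne_top]
    refine setLIntegral_congr_fun measurableSet_Ioi fun x (hx : 0 < x) => ?_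
    have hx' : 0 ≤ x ^ (a - 1) := by positivity
    simp only [mul_assoc, ENNReal.ofReal_mul hx']
    rw [lintegral_const_mul' _ _ ENNReal.ofReal_ne_top, hG hab (by positivity : 0 < 1 + x),
      ENNReal.ofReal_mul (by positivity)]
    ring
  have hR : ∫⁻ t in Ioi (0:ℝ), ∫⁻ x in Ioi (0:ℝ),
        ENNReal.ofReal (x ^ (a - 1) * t ^ (a + b - 1) * rexp (-((1 + x) * t))) =
      ENNReal.ofReal (Real.Gamma a * Real.Gamma b) := by
    have h1 : ENNReal.ofReal (Real.Gamma a * Real.Gamma b) = ∫⁻ t in Ioi (0:ℝ),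
        ENNReal.ofReal (Real.Gamma a) * ENNReal.ofReal (t ^ (b - 1) * rexp (-(1 * t))) := by
      rw [lintegral_const_mul' _ _ ENNReal.ofReal_ne_top, hG hb one_pos,
        ENNReal.ofReal_mul (Gamma_pos_of_pos ha).le, one_rpow, one_mul]
    rw [h1]
    refine setLIntegral_congr_fun measurableSet_Ioi fun t (ht : 0 < t) => ?_
    have h2 (x : ℝ) : ENNReal.ofReal (x ^ (a - 1) * t ^ (a + b - 1) * rexp (-((1 + x) * t))) =
        ENNReal.ofReal (t ^ (a + b - 1) * rexp (-t)) *
          ENNReal.ofReal (x ^ (a - 1) * rexp (-(t * x))) := by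
      rw [← ENNReal.ofReal_mul (by positivity),
        show -((1 + x) * t) = -t + -(t * x) by ring, Real.exp_add]
      ring_nf
    simp only [h2]
    rw [lintegral_const_mul' _ _ ENNReal.ofReal_ne_top, hG ha ht,
      ← ENNReal.ofReal_mul (by positivity), ← ENNReal.ofReal_mul (Gamma_pos_of_pos ha).le,
      show a + b - 1 = (b - 1) + a by ring, rpow_add ht, rpow_neg ht.le]
    have : t ^ a ≠ 0 := (rpow_pos_of_pos ht a).ne'
    congr 1
    field_simp
  rw [ENNReal.ofReal_div_of_pos (Gamma_pos_of_pos hab), ← hR, ← key, hL, mul_comm,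
    ENNReal.mul_div_cancel_right (ENNReal.ofReal_pos.2 (Gamma_pos_of_pos hab)).ne'
      ENNReal.ofReal_ne_top]

theorem integrableOn_rpow_mul_one_add_rpow {a b : ℝ} (ha : 0 < a) (hb : 0 < b) :
    IntegrableOn (fun x : ℝ => x ^ (a - 1) * (1 + x) ^ (-(a + b))) (Ioi 0) := by
  refine (lintegral_ofReal_ne_top_iff_integrable (by fun_prop) ?_).1 ?_
  · filter_upwards [ae_restrict_mem measurableSet_Ioi] with x (hx : 0 < x)
    simp only [Pi.zero_apply]
    positivity
  · rw [lintegral_rpow_mul_one_add_rpow ha hb]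
    exact ENNReal.ofReal_ne_top

theorem integral_rpow_mul_one_add_rpow {a b : ℝ} (ha : 0 < a) (hb : 0 < b) :
    ∫ x in Ioi (0:ℝ), x ^ (a - 1) * (1 + x) ^ (-(a + b)) =
      Real.Gamma a * Real.Gamma b / Real.Gamma (a + b) := by
  rw [integral_eq_lintegral_of_nonneg_ae _ (by fun_prop), lintegral_rpow_mul_one_add_rpow ha hb,
    ENNReal.toReal_ofReal]
  · have := Gamma_pos_of_pos ha
    have := Gamma_pos_of_pos hb
    have := Gamma_pos_of_pos (add_pos ha hb)
    positivity
  · filter_upwards [ae_restrict_mem measurableSet_Ioi] with x (hx : 0 < x)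
    simp only [Pi.zero_apply]
    positivity

theorem one_sub_mul_le_one_add_rpow_neg {l x : ℝ} (hl : 0 ≤ l) (hx : 0 ≤ x) :
    1 - l * x ≤ (1 + x) ^ (-l) := by
  rw [rpow_def_of_pos (by positivity)]
  have h1 := Real.add_one_le_exp (Real.log (1 + x) * -l)
  have h2 := Real.log_le_sub_one_of_pos (by positivity : 0 < 1 + x)
  nlinarith

theorem one_add_rpow_neg_le_one {l x : ℝ} (hl : 0 ≤ l) (hx : 0 ≤ x) : (1 + x) ^ (-l) ≤ 1 :=
  rpow_le_one_of_one_le_of_nonpos (by linarith) (by linarith)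

theorem one_add_rpow_neg_le {l x : ℝ} (hl : 0 ≤ l) (hx : 0 ≤ x) :
    (1 + x) ^ (-l) ≤ 1 - l * x + l * (l + 1) * x ^ 2 := by
  have h1 := one_add_mul_self_le_rpow_one_add (by linarith : -1 ≤ x) (by linarith : 1 ≤ l + 1)
  have hy : 0 < 1 + x := by positivity
  have h2 : (1 + x) ^ (-l) * (1 + x) ^ (l + 1) = 1 + x := by
    rw [← rpow_add hy]
    simp
  have h3 : (1 + x) ^ (-l) * (1 + (l + 1) * x) ≤ 1 + x := by
    exact (mul_le_mul_of_nonneg_left h1 (by positivity)).trans_eq h2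
  have hd : 0 < 1 + (l + 1) * x := by positivity
  refine le_of_mul_le_mul_right (h3.trans ?_) hd
  have : 0 ≤ l * (l + 1) ^ 2 * x ^ 3 := by positivity
  nlinarith

section SecondOrderRemainder

variable {α l : ℝ}

theorem integrableOn_remainder_mul_rpow (hα : α ∈ Ioo (1:ℝ) 2) (hl : 0 ≤ l) :
    IntegrableOn (fun x : ℝ => ((1 + x) ^ (-l) - 1 + l * x) * x ^ (-1 - α)) (Ioi 0) := by
  obtain ⟨h1, h2⟩ := hα
  rw [← Ioc_union_Ioi_eq_Ioi zero_le_one, integrableOn_union]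
  constructor
  · have h := (intervalIntegral.intervalIntegrable_rpow' (a := 0) (b := 1)
      (by linarith : -1 < 1 - α)).const_mul (l * (l + 1))
    rw [intervalIntegrable_iff_integrableOn_Ioc_of_le zero_le_one] at h
    refine h.mono' (by fun_prop) ?_
    filter_upwards [ae_restrict_mem measurableSet_Ioc] with x hx
    have hx0 : 0 < x := hx.1
    have hf := one_sub_mul_le_one_add_rpow_neg hl hx0.le
    have hf' := one_add_rpow_neg_le hl hx0.le
    have hp : x ^ (1 - α) = x ^ 2 * x ^ (-1 - α) := by
      rw [← rpow_natCast, ← rpow_add hx0]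
      norm_num
      ring_nf
    rw [Real.norm_of_nonneg (mul_nonneg (by linarith) (by positivity)), hp, ← mul_assoc]
    gcongr
    linarith
  · refine ((integrableOn_Ioi_rpow_of_lt (by linarith : -α < -1) one_pos).const_mul l).mono'
      (by fun_prop) ?_
    filter_upwards [ae_restrict_mem measurableSet_Ioi] with x (hx : 1 < x)
    have hx0 : 0 < x := by linarith
    have hf := one_sub_mul_le_one_add_rpow_neg hl hx0.le
    have hf' := one_add_rpow_neg_le_one hl hx0.le
    have hp : x ^ (-α) = x * x ^ (-1 - α) := by
      rw [← rpow_one_add' hx0.le (by linarith)]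
      ring_nf
    rw [Real.norm_of_nonneg (mul_nonneg (by linarith) (by positivity)), hp, ← mul_assoc]
    gcongr
    linarith

/-- The boundary term of the twofold integration by parts. -/
noncomputable def remainderBoundary (α l x : ℝ) : ℝ :=
  ((1 + x) ^ (-l) - 1 + l * x) * x ^ (-α) / α +
    l * (1 - (1 + x) ^ (-(l + 1))) * x ^ (1 - α) / (α * (α - 1))

theorem remainderBoundary_nonneg (hα : 1 < α) (hl : 0 ≤ l) {x : ℝ} (hx : 0 ≤ x) :
    0 ≤ remainderBoundary α l x := by
  have hf := one_sub_mul_le_one_add_rpow_neg hl hx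
  have hg := one_add_rpow_neg_le_one (by linarith : 0 ≤ l + 1) hx
  have h1 : 0 ≤ (1 + x) ^ (-l) - 1 + l * x := by linarith
  have h2 : 0 ≤ 1 - (1 + x) ^ (-(l + 1)) := by linarith
  have h3 : 0 < α - 1 := by linarith
  unfold remainderBoundary
  positivity

theorem remainderBoundary_le_near_zero (hα : 1 < α) (hl : 0 ≤ l) {x : ℝ} (hx : 0 < x) :
    remainderBoundary α l x ≤
      (l * (l + 1) / α + l * (l + 1) / (α * (α - 1))) * x ^ (2 - α) := by
  have hf := one_add_rpow_neg_le hl hx.le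
  have hg := one_sub_mul_le_one_add_rpow_neg (by linarith : 0 ≤ l + 1) hx.le
  have h3 : 0 < α - 1 := by linarith
  have hp : x ^ (2 - α) = x ^ 2 * x ^ (-α) := by
    rw [← rpow_natCast, ← rpow_add hx]
    norm_num
    ring_nf
  have hq : x ^ (2 - α) = x * x ^ (1 - α) := by
    rw [show 2 - α = 1 + (1 - α) by ring, rpow_add hx, rpow_one]
  calc remainderBoundary α l x
      ≤ (l * (l + 1) * x ^ 2) * x ^ (-α) / α +
          l * ((l + 1) * x) * x ^ (1 - α) / (α * (α - 1)) := by
        unfold remainderBoundary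
        gcongr <;> linarith
    _ = l * (l + 1) / α * (x ^ 2 * x ^ (-α)) +
          l * (l + 1) / (α * (α - 1)) * (x * x ^ (1 - α)) := by ring
    _ = _ := by rw [← hp, ← hq]; ring

theorem remainderBoundary_le_at_infty (hα : 1 < α) (hl : 0 ≤ l) {x : ℝ} (hx : 0 < x) :
    remainderBoundary α l x ≤ (l / α + l / (α * (α - 1))) * x ^ (1 - α) := by
  have hf := one_add_rpow_neg_le_one hl hx.le
  have hg : 0 ≤ (1 + x) ^ (-(l + 1)) := by positivity
  have h3 : 0 < α - 1 := by linarith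
  have hp : x ^ (1 - α) = x * x ^ (-α) := by
    rw [← rpow_one_add' hx.le (by linarith)]
    ring_nf
  calc remainderBoundary α l x
      ≤ (l * x) * x ^ (-α) / α + l * 1 * x ^ (1 - α) / (α * (α - 1)) := by
        unfold remainderBoundary
        gcongr <;> linarith
    _ = l / α * (x * x ^ (-α)) + l / (α * (α - 1)) * x ^ (1 - α) := by ring
    _ = _ := by rw [← hp]; ring

theorem hasDerivAt_remainderBoundary (hα : 1 < α) {x : ℝ} (hx : 0 < x) :
    HasDerivAt (remainderBoundary α l)
      (l * (l + 1) / (α * (α - 1)) * (x ^ (2 - α - 1) * (1 + x) ^ (-(2 - α + (l + α)))) -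
        ((1 + x) ^ (-l) - 1 + l * x) * x ^ (-1 - α)) x := by
  have hy : 1 + x ≠ 0 := by positivity
  have hd (p : ℝ) : HasDerivAt (fun x : ℝ => (1 + x) ^ p) (p * (1 + x) ^ (p - 1)) x := by
    simpa using ((hasDerivAt_id x).const_add 1).rpow_const (p := p) (Or.inl hy)
  have hx' (p : ℝ) : HasDerivAt (fun x : ℝ => x ^ p) (p * x ^ (p - 1)) x :=
    hasDerivAt_rpow_const (Or.inl hx.ne')
  have H := (((((hd (-l)).sub_const 1).add ((hasDerivAt_id x).const_mul l)).mul
    (hx' (-α))).div_const α).add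
    (((((hd (-(l + 1))).const_sub 1).const_mul l).mul (hx' (1 - α))).div_const (α * (α - 1)))
  refine H.congr_deriv ?_
  have hα0 : α ≠ 0 := by linarith
  have hα1 : α - 1 ≠ 0 := by linarith
  simp only [Pi.add_apply, id]
  rw [show -(2 - α + (l + α)) = -(l + 1) - 1 by ring, show -l - 1 = -(l + 1) by ring,
    show 2 - α - 1 = 1 - α by ring, show 1 - α - 1 = -α by ring, show -α - 1 = -1 - α by ring]
  field_simp
  ring

theorem integral_remainder_mul_rpow (hα : α ∈ Ioo (1:ℝ) 2) (hl : 0 ≤ l) :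
    ∫ x in Ioi (0:ℝ), ((1 + x) ^ (-l) - 1 + l * x) * x ^ (-1 - α) =
      l * (l + 1) / (α * (α - 1)) *
        (Real.Gamma (2 - α) * Real.Gamma (l + α) / Real.Gamma (l + 2)) := by
  have hF := integrableOn_remainder_mul_rpow hα hl
  obtain ⟨h1, h2⟩ := hα
  have ha : 0 < 2 - α := by linarith
  have hb : 0 < l + α := by linarith
  have hH := (integrableOn_rpow_mul_one_add_rpow ha hb).const_mul (l * (l + 1) / (α * (α - 1)))
  have h0 : remainderBoundary α l 0 = 0 := by simp [remainderBoundary]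
  have hcont : ContinuousWithinAt (remainderBoundary α l) (Ici 0) 0 := by
    rw [← continuousWithinAt_Ioi_iff_Ici, ContinuousWithinAt, h0]
    have hlim : Tendsto (fun x : ℝ => (l * (l + 1) / α + l * (l + 1) / (α * (α - 1))) *
        x ^ (2 - α)) (𝓝[>] 0) (𝓝 0) := by
      have h := ((continuous_rpow_const ha.le).tendsto 0).const_mul
        (l * (l + 1) / α + l * (l + 1) / (α * (α - 1)))
      rw [zero_rpow ha.ne', mul_zero] at h
      exact h.mono_left nhdsWithin_le_nhds
    refine tendsto_of_tendsto_of_tendsto_of_le_of_le' tendsto_const_nhds hlim ?_ ?_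
    · filter_upwards [self_mem_nhdsWithin] with x (hx : 0 < x)
      exact remainderBoundary_nonneg h1 hl hx.le
    · filter_upwards [self_mem_nhdsWithin] with x (hx : 0 < x)
      exact remainderBoundary_le_near_zero h1 hl hx
  have htop : Tendsto (remainderBoundary α l) atTop (𝓝 0) := by
    have hlim := (tendsto_rpow_neg_atTop (by linarith : 0 < α - 1)).const_mul
      (l / α + l / (α * (α - 1)))
    rw [mul_zero, neg_sub] at hlim
    refine tendsto_of_tendsto_of_tendsto_of_le_of_le' tendsto_const_nhds hlim ?_ ?_
    · filter_upwards [eventually_gt_atTop 0] with x hx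
      exact remainderBoundary_nonneg h1 hl hx.le
    · filter_upwards [eventually_gt_atTop 0] with x hx
      exact remainderBoundary_le_at_infty h1 hl hx
  have h := integral_Ioi_of_hasDerivAt_of_tendsto hcont
    (fun x hx => hasDerivAt_remainderBoundary h1 hx) (hH.sub hF) htop
  rw [integral_sub hH hF, h0, integral_const_mul, integral_rpow_mul_one_add_rpow ha hb,
    show 2 - α + (l + α) = l + 2 by ring] at h
  linarith

end SecondOrderRemainder

theorem Gamma_two_sub {α : ℝ} (h0 : α ≠ 0) (h1 : α ≠ 1) :
    Real.Gamma (2 - α) = α * (α - 1) * Real.Gamma (-α) := by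
  have e1 := Real.Gamma_add_one (neg_ne_zero.2 h0)
  have e2 := Real.Gamma_add_one (sub_ne_zero.2 h1.symm)
  rw [show -α + 1 = 1 - α by ring] at e1
  rw [show 1 - α + 1 = 2 - α by ring, e1] at e2
  rw [e2]
  ring

theorem mul_div_Gamma_add_two {l : ℝ} (hl : 0 ≤ l) :
    l * (l + 1) / Real.Gamma (l + 2) = 1 / Real.Gamma l := by
  rcases hl.eq_or_lt with rfl | hl
  · simp
  rw [show l + 2 = l + 1 + 1 by ring, Real.Gamma_add_one (by positivity),
    Real.Gamma_add_one hl.ne']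
  have := (Gamma_pos_of_pos hl).ne'
  field_simp

/-- For `λ ≥ 0`, `∫₁^∞ (y^{-λ} - 1 + λ(y-1))/(Γ(-α)(y-1)^{1+α}) dy = Γ(λ+α)/Γ(λ)`.
For `λ = 0` the right-hand side is `0` (consistent with `Real.Gamma 0 = 0`, so that
`Γ(α)/Γ(0) = 0` with Lean's division-by-zero convention). -/
theorem stmt10 (α : ℝ) (hα : α ∈ Ioo (1:ℝ) 2) :
    ∀ l : ℝ, 0 ≤ l →
      IntegrableOn
        (fun y : ℝ => (y ^ (-l) - 1 + l * (y - 1)) / (Real.Gamma (-α) * (y - 1) ^ (1 + α)))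
        (Ioi 1) ∧
      ∫ y in Ioi (1:ℝ),
          (y ^ (-l) - 1 + l * (y - 1)) / (Real.Gamma (-α) * (y - 1) ^ (1 + α)) =
        Real.Gamma (l + α) / Real.Gamma l := by
  intro l hl
  have h1 := hα.1
  have h2 := hα.2
  set g : ℝ → ℝ :=
    fun y => (y ^ (-l) - 1 + l * (y - 1)) / (Real.Gamma (-α) * (y - 1) ^ (1 + α)) with hg
  have hshift : EqOn (fun x => g (x + 1))
      (fun x => (Real.Gamma (-α))⁻¹ * (((1 + x) ^ (-l) - 1 + l * x) * x ^ (-1 - α))) (Ioi 0) := by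
    intro x (hx : 0 < x)
    simp only [hg]
    rw [add_sub_cancel_right, add_comm x 1, show -1 - α = -(1 + α) by ring, rpow_neg hx.le]
    ring
  have hmp := measurePreserving_add_right (volume : Measure ℝ) 1
  have hme := measurableEmbedding_addRight (1 : ℝ)
  have hpre : (fun x : ℝ => x + 1) ⁻¹' Ioi 1 = Ioi 0 := by ext; simp
  constructor
  · rw [← hmp.integrableOn_comp_preimage hme, hpre]
    exact IntegrableOn.congr_fun ((integrableOn_remainder_mul_rpow hα hl).const_mul _)
      hshift.symm measurableSet_Ioi
  · rw [← hmp.setIntegral_preimage_emb hme, hpre, setIntegral_congr_fun measurableSet_Ioi hshift,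
      integral_const_mul, integral_remainder_mul_rpow hα hl, div_eq_mul_one_div _ (Real.Gamma l),
      ← mul_div_Gamma_add_two hl]
    have hG2 := Gamma_two_sub (by linarith : α ≠ 0) h1.ne'
    have hpos : Real.Gamma (2 - α) ≠ 0 := (Gamma_pos_of_pos (by linarith)).ne'
    have hG : Real.Gamma (-α) ≠ 0 := by
      rintro h
      exact hpos (by rw [hG2, h, mul_zero])
    have hα0 : α ≠ 0 := by linarith
    have hα1 : α - 1 ≠ 0 := by linarith
    rw [hG2]
    field_simp
end

section
/- Let β ∈ (0,1) and let A, B be independent random variables each distributed as a standard positive β-stable law (with Laplace transform E[e^{-λA}] = e^{-λ^β}). Then the quotient A/B has the same law as Y_β = Z_β^{1/β}, where Z_β has density t ↦ sin(πβ)/(πβ(t² + 2t cos(πβ) + 1)) on (0,∞); equivalently, (A/B)^β has density sin(πβ)/(πβ(t² + 2t cos(πβ) + 1)). -/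
open Real MeasureTheory Set ProbabilityTheory

/-- Two functions that are analytic on an open vertical strip and agree at its real points
agree on the whole strip. -/
lemma AnalyticOnNhd.eqOn_strip_of_eqOn_real {f g : ℂ → ℂ} {I : Set ℝ} (hIo : IsOpen I)
    (hIc : Convex ℝ I) (hf : AnalyticOnNhd ℂ f {z | z.re ∈ I})
    (hg : AnalyticOnNhd ℂ g {z | z.re ∈ I}) (h : ∀ t ∈ I, f (t : ℝ) = g (t : ℝ)) :
    EqOn f g {z | z.re ∈ I} := by
  rcases I.eq_empty_or_nonempty with rfl | ⟨t, ht⟩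
  · simp
  refine AnalyticOnNhd.eqOn_of_preconnected_of_frequently_eq hf hg
    (hIc.linear_preimage Complex.reLm).isPreconnected (z₀ := (t : ℂ)) (by simpa using ht) ?_
  have h_real : ∃ᶠ x : ℝ in nhdsWithin t {t}ᶜ, f x = g x :=
    Filter.Eventually.frequently
      (Filter.Eventually.filter_mono nhdsWithin_le_nhds
        (Filter.mem_of_superset (hIo.mem_nhds ht) h))
  have h_tendsto : Filter.Tendsto (fun x : ℝ ↦ (x : ℂ)) (nhdsWithin t {t}ᶜ)
      (nhdsWithin (t : ℂ) {(t : ℂ)}ᶜ) := by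
    refine Complex.continuous_ofReal.continuousAt.continuousWithinAt.tendsto_nhdsWithin ?_
    intro x hx
    simpa using hx
  exact h_tendsto.frequently h_real

/-- Two measures on `ℝ` whose moment generating functions are finite and agree on a nonempty open
interval are equal. -/
lemma MeasureTheory.Measure.ext_of_lintegral_exp_mul {ν ν' : Measure ℝ} {a b : ℝ} (hab : a < b)
    (hfin : ∀ t ∈ Ioo a b, ∫⁻ x, ENNReal.ofReal (exp (t * x)) ∂ν ≠ ⊤)
    (heq : ∀ t ∈ Ioo a b, ∫⁻ x, ENNReal.ofReal (exp (t * x)) ∂ν =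
      ∫⁻ x, ENNReal.ofReal (exp (t * x)) ∂ν') : ν = ν' := by
  have key (m : Measure ℝ) (hm : ∀ t ∈ Ioo a b, ∫⁻ x, ENNReal.ofReal (exp (t * x)) ∂m ≠ ⊤) :
      Ioo a b ⊆ interior (integrableExpSet id m) :=
    isOpen_Ioo.subset_interior_iff.2 fun t ht ↦
      (lintegral_ofReal_ne_top_iff_integrable (by fun_prop) (ae_of_all _ fun x ↦ (exp_pos _).le)).1
        (hm t ht)
  have hfin' : ∀ t ∈ Ioo a b, ∫⁻ x, ENNReal.ofReal (exp (t * x)) ∂ν' ≠ ⊤ :=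
    fun t ht ↦ heq t ht ▸ hfin t ht
  have hmgf : EqOn (complexMGF id ν) (complexMGF id ν') {z | z.re ∈ Ioo a b} := by
    refine AnalyticOnNhd.eqOn_strip_of_eqOn_real isOpen_Ioo (convex_Ioo a b)
      (analyticOnNhd_complexMGF.mono fun z hz ↦ key ν hfin hz)
      (analyticOnNhd_complexMGF.mono fun z hz ↦ key ν' hfin' hz) fun t ht ↦ ?_
    rw [complexMGF_ofReal, complexMGF_ofReal, mgf, mgf,
      integral_eq_lintegral_of_nonneg_ae (ae_of_all _ fun x ↦ (exp_pos _).le) (by fun_prop),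
      integral_eq_lintegral_of_nonneg_ae (ae_of_all _ fun x ↦ (exp_pos _).le) (by fun_prop)]
    simpa using congrArg (fun y ↦ ((y.toReal : ℝ) : ℂ)) (heq t ht)
  obtain ⟨c, hc⟩ := nonempty_Ioo.2 hab
  let w : ℝ → ENNReal := fun x ↦ ENNReal.ofReal (exp (c * x))
  have hw : Measurable w := by fun_prop
  have hchar (m : Measure ℝ) (t : ℝ) :
      charFun (m.withDensity w) t = complexMGF id m (c + t * Complex.I) := by
    rw [charFun_apply_real, complexMGF, integral_withDensity_eq_integral_toReal_smul hw
      (ae_of_all _ fun x ↦ ENNReal.ofReal_lt_top)]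
    refine integral_congr_ae (ae_of_all _ fun x ↦ ?_)
    simp only [w, ENNReal.toReal_ofReal (exp_pos _).le, Complex.real_smul, Complex.ofReal_exp,
      ← Complex.exp_add, id]
    push_cast
    ring_nf
  have hwd (m : Measure ℝ) (hm : ∀ t ∈ Ioo a b, ∫⁻ x, ENNReal.ofReal (exp (t * x)) ∂m ≠ ⊤) :
      IsFiniteMeasure (m.withDensity w) :=
    isFiniteMeasure_withDensity (hm c hc)
  have := hwd ν hfin
  have := hwd ν' hfin'
  have hww : ν.withDensity w = ν'.withDensity w := by
    refine Measure.ext_of_charFun (funext fun t ↦ ?_)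
    rw [hchar, hchar]
    exact hmgf (by simpa using hc)
  have hinv (m : Measure ℝ) : (m.withDensity w).withDensity (fun x ↦ (w x)⁻¹) = m :=
    withDensity_inv_same hw (ae_of_all _ fun x ↦ by simp [w, exp_pos])
      (ae_of_all _ fun x ↦ ENNReal.ofReal_ne_top)
  rw [← hinv ν, hww, hinv]

lemma integrableOn_rpow_mul_exp_neg_mul {s r : ℝ} (hs : 0 < s) (hr : 0 < r) :
    IntegrableOn (fun t : ℝ ↦ t ^ (s - 1) * exp (-(r * t))) (Ioi 0) := by
  simpa using integrableOn_rpow_mul_exp_neg_mul_rpow (p := 1) (s := s - 1) (by linarith)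
    one_pos hr

/-- Euler's integral for the Gamma function along a ray in the right half plane. -/
lemma integral_rpow_mul_cexp_neg_exp_mul_Ioi {s : ℝ} (hs : 0 < s) {w : ℂ}
    (hw : |w.im| < π / 2) :
    ∫ t in Ioi (0 : ℝ), ((t ^ (s - 1) : ℝ) : ℂ) * Complex.exp (-(Complex.exp w * t)) =
      Gamma s * Complex.exp (-(s * w)) := by
  let d : ℝ → ENNReal := fun t ↦ ENNReal.ofReal (t ^ (s - 1))
  have hd : Measurable d := by fun_prop
  let m : Measure ℝ := (volume.restrict (Ioi 0)).withDensity d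
  have hm (z : ℂ) : complexMGF id m z =
      ∫ t in Ioi (0 : ℝ), ((t ^ (s - 1) : ℝ) : ℂ) * Complex.exp (z * t) := by
    rw [complexMGF, integral_withDensity_eq_integral_toReal_smul hd
      (ae_of_all _ fun x ↦ ENNReal.ofReal_lt_top)]
    refine setIntegral_congr_fun measurableSet_Ioi fun t ht ↦ ?_
    simp only [d, ENNReal.toReal_ofReal (rpow_nonneg (le_of_lt ht) _), Complex.real_smul, id]
  have hint : Iio 0 ⊆ interior (integrableExpSet id m) := by
    refine isOpen_Iio.subset_interior_iff.2 fun t ht ↦ ?_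
    simp only [integrableExpSet, mem_ofPred_eq, m]
    rw [integrable_withDensity_iff_integrable_smul' hd
      (ae_of_all _ fun x ↦ ENNReal.ofReal_lt_top)]
    refine (integrableOn_rpow_mul_exp_neg_mul hs (neg_pos.2 ht)).congr_fun (fun x hx ↦ ?_)
      measurableSet_Ioi
    simp [d, ENNReal.toReal_ofReal (rpow_nonneg (le_of_lt hx) _)]
  have hEq : EqOn (complexMGF id m) (fun z ↦ Gamma s * (-z) ^ (-(s : ℂ))) {z | z.re ∈ Iio 0} := by
    refine AnalyticOnNhd.eqOn_strip_of_eqOn_real isOpen_Iio (convex_Iio 0)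
      (analyticOnNhd_complexMGF.mono fun z hz ↦ hint hz) ?_ fun t ht ↦ ?_
    · refine DifferentiableOn.analyticOnNhd (fun z hz ↦ ?_)
        (isOpen_Iio.preimage Complex.continuous_re)
      refine DifferentiableAt.differentiableWithinAt ?_
      refine DifferentiableAt.const_mul (DifferentiableAt.cpow_const (by fun_prop) ?_) _
      left
      simpa using hz
    · have h := integral_rpow_mul_exp_neg_mul_Ioi hs (neg_pos.2 ht)
      rw [hm]
      have e : ((-t : ℂ)) ^ (-(s : ℂ)) = (((-t) ^ (-s) : ℝ) : ℂ) := by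
        rw [Complex.ofReal_cpow (neg_pos.2 ht).le]; simp
      rw [e, ← Complex.ofReal_mul]
      have h2 : Gamma s * (-t) ^ (-s) = (1 / (-t)) ^ s * Gamma s := by
        rw [one_div, inv_rpow (neg_pos.2 ht).le, rpow_neg (neg_pos.2 ht).le, mul_comm]
      rw [h2, ← h, ← integral_complex_ofReal]
      refine integral_congr_ae (ae_of_all _ fun x ↦ ?_)
      push_cast
      simp
  have hre : 0 < (Complex.exp w).re := by
    rw [Complex.exp_re]
    exact mul_pos (exp_pos _) (cos_pos_of_mem_Ioo (abs_lt.1 hw))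
  have h := hEq (x := -Complex.exp w) (by simpa using hre)
  rw [hm] at h
  simp only [neg_neg] at h
  have hπ := pi_pos
  have := abs_lt.1 hw
  rw [Complex.cpow_def_of_ne_zero (Complex.exp_ne_zero w),
    Complex.log_exp (by linarith) (by linarith)] at h
  simpa [mul_comm] using h

/-- A Stieltjes-type integral with both coefficients on rays in the right half plane. -/
lemma integral_rpow_div_exp_mul_add_exp_neg {p : ℝ} (hp : p ∈ Ioo (0 : ℝ) 1) {w : ℂ}
    (hw : |w.im| < π / 2) :
    IntegrableOn (fun t : ℝ ↦ ((t ^ (-p) : ℝ) : ℂ) *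
      (Complex.exp w * t + Complex.exp (-w))⁻¹) (Ioi 0) ∧
    ∫ t in Ioi (0 : ℝ), ((t ^ (-p) : ℝ) : ℂ) * (Complex.exp w * t + Complex.exp (-w))⁻¹ =
      Gamma p * Gamma (1 - p) * Complex.exp ((2 * p - 1) * w) := by
  have hp1 : 0 < 1 - p := by linarith [hp.2]
  have hre : 0 < (Complex.exp w).re := by
    rw [Complex.exp_re]
    exact mul_pos (exp_pos _) (cos_pos_of_mem_Ioo (abs_lt.1 hw))
  have hre' : 0 < (Complex.exp (-w)).re := by
    rw [Complex.exp_re]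
    refine mul_pos (exp_pos _) (cos_pos_of_mem_Ioo (abs_lt.1 ?_))
    simpa using hw
  let F : ℝ → ℝ → ℂ := fun t u ↦
    ((t ^ (-p) : ℝ) : ℂ) * Complex.exp (-((Complex.exp w * t + Complex.exp (-w)) * u))
  have hFm : Measurable (Function.uncurry F) := by
    unfold F Function.uncurry
    fun_prop
  have hnorm (t : ℝ) (ht : 0 < t) (u : ℝ) : ‖F t u‖ =
      t ^ (1 - p - 1) * exp (-(((Complex.exp w).re * u) * t)) *
        exp (-((Complex.exp (-w)).re * u)) := by
    simp only [F, norm_mul, Complex.norm_exp, Complex.norm_real,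
      norm_of_nonneg (rpow_nonneg ht.le (-p))]
    rw [mul_assoc, ← exp_add]
    congr 2
    · ring
    · simp
      ring
  have hGamma (u : ℝ) (hu : 0 < u) :
      ∫ t in Ioi (0 : ℝ), F t u = Gamma (1 - p) * Complex.exp (-((1 - p) * w)) *
        (((u ^ (p - 1) : ℝ) : ℂ) * Complex.exp (-(Complex.exp (-w) * u))) := by
    have h := integral_rpow_mul_cexp_neg_exp_mul_Ioi hp1 (w := Real.log u + w) (by simpa using hw)
    have e : Complex.exp (Real.log u + w) = u * Complex.exp w := by
      rw [Complex.exp_add, ← Complex.ofReal_exp, exp_log hu]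
    have e2 : ((u ^ (p - 1) : ℝ) : ℂ) = Complex.exp (-((1 - p) * Real.log u)) := by
      rw [rpow_def_of_pos hu]
      push_cast
      ring_nf
    calc ∫ t in Ioi (0 : ℝ), F t u
        = ∫ t in Ioi (0 : ℝ), Complex.exp (-(Complex.exp (-w) * u)) *
          (((t ^ (1 - p - 1) : ℝ) : ℂ) * Complex.exp (-(Complex.exp (Real.log u + w) * t))) := by
          refine setIntegral_congr_fun measurableSet_Ioi fun t ht ↦ ?_
          simp only [F, e]
          rw [mul_left_comm, ← Complex.exp_add]
          congr 2
          · ring_nf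
          · ring
      _ = _ := by
          rw [integral_const_mul, h, e2, mul_add, neg_add, Complex.exp_add]
          push_cast
          ring
  have hFint : Integrable (Function.uncurry F)
      ((volume.restrict (Ioi 0)).prod (volume.restrict (Ioi 0))) := by
    rw [integrable_prod_iff' hFm.aestronglyMeasurable]
    refine ⟨?_, ?_⟩
    · refine ae_restrict_of_forall_mem measurableSet_Ioi fun u hu ↦ ?_
      refine (integrable_norm_iff ?_).1 ?_
      · exact (hFm.comp (measurable_prodMk_right (y := u))).aestronglyMeasurable
      · exact IntegrableOn.congr_fun
          ((integrableOn_rpow_mul_exp_neg_mul hp1 (mul_pos hre hu)).mul_const _)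
          (fun t ht ↦ (hnorm t ht u).symm) measurableSet_Ioi
    · have hc : IntegrableOn (fun u : ℝ ↦ (1 / (Complex.exp w).re) ^ (1 - p) * Gamma (1 - p) *
          (u ^ (p - 1) * exp (-((Complex.exp (-w)).re * u)))) (Ioi 0) :=
        (integrableOn_rpow_mul_exp_neg_mul hp.1 hre').const_mul _
      refine hc.congr_fun (fun u hu ↦ ?_) measurableSet_Ioi
      have hu' : 0 < u := hu
      simp only [Function.uncurry]
      rw [setIntegral_congr_fun measurableSet_Ioi fun t ht ↦ hnorm t ht u, integral_mul_const,
        integral_rpow_mul_exp_neg_mul_Ioi hp1 (mul_pos hre hu), ← one_div_mul_one_div,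
        mul_rpow (by positivity) (by positivity), one_div u, inv_rpow hu'.le, ← rpow_neg hu'.le,
        neg_sub]
      ring
  have hinner (t : ℝ) (ht : 0 < t) : ∫ u in Ioi (0 : ℝ), F t u =
      ((t ^ (-p) : ℝ) : ℂ) * (Complex.exp w * t + Complex.exp (-w))⁻¹ := by
    have h := integral_exp_mul_complex_Ioi (a := -(Complex.exp w * t + Complex.exp (-w)))
      (by simp; nlinarith [mul_pos hre ht]) 0
    simp only [F]
    rw [integral_const_mul]
    congr 1
    simpa only [neg_mul, Complex.ofReal_zero, mul_zero, neg_zero, Complex.exp_zero, neg_div_neg_eq,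
      one_div] using h
  have hinner' := setIntegral_congr_fun (μ := volume) measurableSet_Ioi hinner
  refine ⟨IntegrableOn.congr_fun hFint.integral_prod_left hinner measurableSet_Ioi, ?_⟩
  rw [← hinner', integral_integral_swap hFint, setIntegral_congr_fun measurableSet_Ioi hGamma,
    integral_const_mul, integral_rpow_mul_cexp_neg_exp_mul_Ioi hp.1 (by simpa using hw)]
  rw [show (2 * (p : ℂ) - 1) * w = -((1 - p) * w) + -(p * -w) by ring, Complex.exp_add]
  ring

/-- The quadratic `t² + 2t cos θ + 1` is positive when `sin θ ≠ 0`. -/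
lemma sq_add_two_mul_mul_cos_add_one_pos {θ : ℝ} (hθ : 0 < sin θ) (t : ℝ) :
    0 < t ^ 2 + 2 * t * cos θ + 1 := by
  nlinarith [sq_nonneg (t + cos θ), sin_sq_add_cos_sq θ, pow_pos hθ 2]

/-- Mellin transform of `t ↦ sin θ / (t² + 2t cos θ + 1)`. -/
lemma integral_rpow_mul_sin_div_quadratic {p θ : ℝ} (hp : p ∈ Ioo (0 : ℝ) 1)
    (hθ : θ ∈ Ioo (0 : ℝ) π) :
    IntegrableOn (fun t : ℝ ↦ t ^ (-p) * (sin θ / (t ^ 2 + 2 * t * cos θ + 1))) (Ioi 0) ∧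
    ∫ t in Ioi (0 : ℝ), t ^ (-p) * (sin θ / (t ^ 2 + 2 * t * cos θ + 1)) =
      Gamma p * Gamma (1 - p) * sin (p * θ) := by
  set w : ℂ := ((-(θ / 2) : ℝ) : ℂ) * Complex.I with hwdef
  have hwim : |w.im| < π / 2 := by
    simp only [hwdef, Complex.im_ofReal_mul, Complex.I_im, mul_one, abs_neg]
    rw [abs_of_pos (by linarith [hθ.1])]
    linarith [hθ.2]
  obtain ⟨hint, hval⟩ := integral_rpow_div_exp_mul_add_exp_neg hp hwim
  have hQ := sq_add_two_mul_mul_cos_add_one_pos (sin_pos_of_mem_Ioo hθ)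
  have hpt (t : ℝ) : -(Complex.exp w * (((t ^ (-p) : ℝ) : ℂ) *
      (Complex.exp w * t + Complex.exp (-w))⁻¹)).im =
      t ^ (-p) * (sin θ / (t ^ 2 + 2 * t * cos θ + 1)) := by
    have e1 : Complex.exp w * Complex.exp (-w) = 1 := by rw [← Complex.exp_add]; simp
    have e2 : Complex.exp w ^ 2 = cos θ - sin θ * Complex.I := by
      rw [← Complex.exp_nat_mul, hwdef,
        show ((2 : ℕ) : ℂ) * (((-(θ / 2) : ℝ) : ℂ) * Complex.I) = ((-θ : ℝ) : ℂ) * Complex.I by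
          push_cast; ring, Complex.exp_mul_I, ← Complex.ofReal_cos, ← Complex.ofReal_sin]
      simp [sub_eq_add_neg]
    have e3 : Complex.exp (-w) ^ 2 = cos θ + sin θ * Complex.I := by
      rw [← Complex.exp_nat_mul, hwdef,
        show ((2 : ℕ) : ℂ) * -(((-(θ / 2) : ℝ) : ℂ) * Complex.I) = (θ : ℂ) * Complex.I by
          push_cast; ring, Complex.exp_mul_I, ← Complex.ofReal_cos, ← Complex.ofReal_sin]
    have e4 : (Complex.exp w * t + Complex.exp (-w)) * (Complex.exp (-w) * t + Complex.exp w) =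
        ((t ^ 2 + 2 * t * cos θ + 1 : ℝ) : ℂ) := by
      push_cast [-Complex.ofReal_cos]
      linear_combination (t ^ 2 + 1 : ℂ) * e1 + (t : ℂ) * e2 + (t : ℂ) * e3
    have hne : (((t ^ 2 + 2 * t * cos θ + 1 : ℝ)) : ℂ) ≠ 0 := Complex.ofReal_ne_zero.2 (hQ t).ne'
    have e5 : (Complex.exp w * t + Complex.exp (-w))⁻¹ = (Complex.exp (-w) * t + Complex.exp w) *
        (((t ^ 2 + 2 * t * cos θ + 1 : ℝ))⁻¹ : ℝ) := by
      refine inv_eq_of_mul_eq_one_right ?_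
      rw [← mul_assoc, e4, Complex.ofReal_inv, mul_inv_cancel₀ hne]
    have e6 : Complex.exp w * (((t ^ (-p) : ℝ) : ℂ) *
        (Complex.exp w * t + Complex.exp (-w))⁻¹) =
        ((t ^ (-p) * (t ^ 2 + 2 * t * cos θ + 1)⁻¹ : ℝ) : ℂ) *
          (((t + cos θ : ℝ) : ℂ) - ((sin θ : ℝ) : ℂ) * Complex.I) := by
      rw [e5]
      push_cast [-Complex.ofReal_cos, -Complex.ofReal_sin]
      linear_combination ((t ^ (-p) : ℝ) : ℂ) * ((t : ℂ) ^ 2 + 2 * t * (cos θ : ℝ) + 1)⁻¹ *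
        (t * e1 + e2)
    rw [e6, Complex.im_ofReal_mul, Complex.sub_im, Complex.ofReal_im, Complex.im_ofReal_mul,
      Complex.I_im]
    ring
  have hint' := (hint.const_mul (Complex.exp w)).im.neg
  refine ⟨hint'.congr (ae_of_all _ hpt), ?_⟩
  have him := integral_im (𝕜 := ℂ) (hint.const_mul (Complex.exp w))
  rw [← integral_congr_ae (ae_of_all _ hpt), integral_neg]
  erw [him]
  rw [integral_const_mul, hval, mul_left_comm, ← Complex.exp_add, hwdef,
    show (((-(θ / 2) : ℝ) : ℂ) * Complex.I) + (2 * p - 1) * (((-(θ / 2) : ℝ) : ℂ) * Complex.I) =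
      ((-(p * θ) : ℝ) : ℂ) * Complex.I by push_cast; ring, ← Complex.ofReal_mul]
  simp [Complex.exp_im]

/-- Fractional moments of a positive random variable from its (weighted) Laplace transform. -/
lemma ofReal_Gamma_mul_lintegral_rpow_neg {Ω : Type*} [MeasurableSpace Ω] {μ : Measure Ω}
    [SFinite μ] {X : Ω → ℝ} (hX : Measurable X) (hpos : ∀ ω, 0 < X ω) {h g : ℝ → ℝ}
    (hm : Measurable h) (h0 : ∀ x, 0 < x → 0 ≤ h x)
    (hL : ∀ u, 0 < u → ∫⁻ ω, ENNReal.ofReal (h (X ω) * exp (-(u * X ω))) ∂μ = ENNReal.ofReal (g u))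
    {s : ℝ} (hs : 0 < s) :
    ENNReal.ofReal (Gamma s) * ∫⁻ ω, ENNReal.ofReal (h (X ω) * X ω ^ (-s)) ∂μ =
      ∫⁻ u in Ioi (0 : ℝ), ENNReal.ofReal (u ^ (s - 1) * g u) := by
  have hω (ω : Ω) : ENNReal.ofReal (Gamma s) * ENNReal.ofReal (h (X ω) * X ω ^ (-s)) =
      ∫⁻ u in Ioi (0 : ℝ), ENNReal.ofReal (u ^ (s - 1)) *
        ENNReal.ofReal (h (X ω) * exp (-(u * X ω))) := by
    have hh := h0 _ (hpos ω)
    calc ENNReal.ofReal (Gamma s) * ENNReal.ofReal (h (X ω) * X ω ^ (-s))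
        = ENNReal.ofReal (∫ u in Ioi (0 : ℝ),
            h (X ω) * (u ^ (s - 1) * exp (-(X ω * u)))) := by
          rw [integral_const_mul, integral_rpow_mul_exp_neg_mul_Ioi hs (hpos ω),
            ← ENNReal.ofReal_mul (Gamma_pos_of_pos hs).le, one_div, inv_rpow (hpos ω).le,
            ← rpow_neg (hpos ω).le]
          ring_nf
      _ = ∫⁻ u in Ioi (0 : ℝ), ENNReal.ofReal (h (X ω) * (u ^ (s - 1) * exp (-(X ω * u)))) := by
          refine ofReal_integral_eq_lintegral_ofReal
            ((integrableOn_rpow_mul_exp_neg_mul hs (hpos ω)).const_mul _) ?_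
          exact ae_restrict_of_forall_mem measurableSet_Ioi fun u hu ↦
            mul_nonneg hh (mul_nonneg (rpow_nonneg (le_of_lt hu) _) (exp_pos _).le)
      _ = _ := by
          refine setLIntegral_congr_fun measurableSet_Ioi fun u hu ↦ ?_
          rw [← ENNReal.ofReal_mul (rpow_nonneg (le_of_lt hu) _)]
          ring_nf
  rw [← lintegral_const_mul _ (by fun_prop), lintegral_congr hω, lintegral_lintegral_swap]
  · refine setLIntegral_congr_fun measurableSet_Ioi fun u hu ↦ ?_
    rw [lintegral_const_mul _ (by fun_prop), hL u hu,
      ENNReal.ofReal_mul (rpow_nonneg (le_of_lt hu) _)]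
  · exact Measurable.aemeasurable (by fun_prop)

lemma lintegral_rpow_mul_exp_neg_rpow {β r : ℝ} (hβ : 0 < β) (hr : -1 < r) :
    ∫⁻ u in Ioi (0 : ℝ), ENNReal.ofReal (u ^ r * exp (-u ^ β)) =
      ENNReal.ofReal (1 / β * Gamma ((r + 1) / β)) := by
  rw [← integral_rpow_mul_exp_neg_rpow hβ hr, ofReal_integral_eq_lintegral_ofReal]
  · simpa [IntegrableOn] using integrableOn_rpow_mul_exp_neg_mul_rpow hr hβ one_pos
  · exact ae_restrict_of_forall_mem measurableSet_Ioi fun u hu ↦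
      mul_nonneg (rpow_nonneg (le_of_lt hu) _) (exp_pos _).le

section Stable

variable {Ω : Type*} [MeasurableSpace Ω] {μ : Measure Ω} [IsProbabilityMeasure μ] {β : ℝ}
  {X : Ω → ℝ}

lemma integrable_exp_mul_of_pos (hX : Measurable X) (hpos : ∀ ω, 0 < X ω) {t : ℝ} (ht : t ≤ 0) :
    Integrable (fun ω ↦ exp (t * X ω)) μ := by
  refine Integrable.of_bound (by fun_prop) 1 (ae_of_all _ fun ω ↦ ?_)
  rw [norm_of_nonneg (exp_pos _).le, exp_le_one_iff]
  exact mul_nonpos_of_nonpos_of_nonneg ht (hpos ω).le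

/-- Negative moments of a positive stable variable. -/
lemma lintegral_rpow_neg_of_stable (hβ : β ∈ Ioo (0 : ℝ) 1) (hX : Measurable X)
    (hpos : ∀ ω, 0 < X ω)
    (hL : ∀ l : ℝ, 0 ≤ l → ∫ ω, exp (-(l * X ω)) ∂μ = exp (-(l ^ β))) {q : ℝ} (hq : 0 < q) :
    ∫⁻ ω, ENNReal.ofReal (X ω ^ (-q)) ∂μ = ENNReal.ofReal (Gamma (q / β) / (β * Gamma q)) := by
  have hG := Gamma_pos_of_pos hq
  have h := ofReal_Gamma_mul_lintegral_rpow_neg (μ := μ) hX hpos (h := fun _ ↦ 1)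
    (g := fun u ↦ exp (-u ^ β)) measurable_const (fun _ _ ↦ zero_le_one) (fun u hu ↦ by
      simp only [one_mul]
      rw [← hL u hu.le, ofReal_integral_eq_lintegral_ofReal]
      · simpa using integrable_exp_mul_of_pos (μ := μ) hX hpos (neg_nonpos.2 hu.le)
      · exact ae_of_all _ fun ω ↦ (exp_pos _).le) hq
  rw [lintegral_rpow_mul_exp_neg_rpow hβ.1 (by linarith)] at h
  simp only [one_mul, sub_add_cancel] at h
  rw [ENNReal.eq_div_iff (by simpa using hG) ENNReal.ofReal_ne_top |>.2 h,
    ← ENNReal.ofReal_div_of_pos hG]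
  congr 1
  field_simp

/-- Positive moments of a positive stable variable. -/
lemma lintegral_rpow_of_stable (hβ : β ∈ Ioo (0 : ℝ) 1) (hX : Measurable X)
    (hpos : ∀ ω, 0 < X ω)
    (hL : ∀ l : ℝ, 0 ≤ l → ∫ ω, exp (-(l * X ω)) ∂μ = exp (-(l ^ β))) {q : ℝ} (hq : q < β) :
    ∫⁻ ω, ENNReal.ofReal (X ω ^ q) ∂μ = ENNReal.ofReal (Gamma (1 - q / β) / Gamma (1 - q)) := by
  have hβ0 := hβ.1
  have hq1 : 0 < 1 - q := by linarith [hβ.2]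
  have hG := Gamma_pos_of_pos hq1
  have hint : Iio 0 ⊆ interior (integrableExpSet X μ) :=
    isOpen_Iio.subset_interior_iff.2 fun t ht ↦ integrable_exp_mul_of_pos hX hpos (le_of_lt ht)
  have hderiv (u : ℝ) (hu : 0 < u) :
      ∫ ω, X ω * exp (-u * X ω) ∂μ = β * (u ^ (β - 1) * exp (-u ^ β)) := by
    have h1 := hasDerivAt_mgf (hint (neg_lt_zero.2 hu))
    have h2 : HasDerivAt (fun t : ℝ ↦ exp (-((-t) ^ β)))
        (β * (u ^ (β - 1) * exp (-u ^ β))) (-u) := by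
      have := ((hasDerivAt_neg (-u)).rpow_const (p := β) (by left; simpa using hu.ne')).neg.exp
      refine this.congr_deriv ?_
      simp only [Pi.neg_apply, neg_neg]
      ring
    refine h1.unique (h2.congr_of_eventuallyEq ?_)
    filter_upwards [isOpen_Iio.mem_nhds (neg_lt_zero.2 hu)] with t ht
    have ht' : 0 ≤ -t := neg_nonneg.2 (le_of_lt ht)
    rw [← hL _ ht', mgf]
    simp
  have h := ofReal_Gamma_mul_lintegral_rpow_neg (μ := μ) hX hpos (h := id)
    (g := fun u ↦ β * (u ^ (β - 1) * exp (-u ^ β))) measurable_id (fun _ hx ↦ hx.le)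
    (fun u hu ↦ by
      rw [← hderiv u hu, ofReal_integral_eq_lintegral_ofReal]
      · simp
      · simpa using integrable_pow_mul_exp_of_mem_interior_integrableExpSet
          (hint (neg_lt_zero.2 hu)) 1
      · exact ae_of_all _ fun ω ↦ mul_nonneg (hpos ω).le (exp_pos _).le) hq1
  have hR : ∫⁻ u in Ioi (0 : ℝ), ENNReal.ofReal
        (u ^ (1 - q - 1) * (β * (u ^ (β - 1) * exp (-u ^ β)))) =
      ENNReal.ofReal (Gamma (1 - q / β)) := by
    calc _ = ∫⁻ u in Ioi (0 : ℝ), ENNReal.ofReal β *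
          ENNReal.ofReal (u ^ (β - 1 - q) * exp (-u ^ β)) := by
          refine setLIntegral_congr_fun measurableSet_Ioi fun u hu ↦ ?_
          rw [← ENNReal.ofReal_mul hβ0.le, show β - 1 - q = (1 - q - 1) + (β - 1) by ring,
            rpow_add hu]
          ring_nf
      _ = _ := by
          rw [lintegral_const_mul _ (by fun_prop),
            lintegral_rpow_mul_exp_neg_rpow hβ0 (by linarith), ← ENNReal.ofReal_mul hβ0.le]
          congr 1
          rw [← mul_assoc, mul_one_div_cancel hβ0.ne', one_mul]
          congr 1
          field_simp
          ring
  rw [hR] at h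
  have hX' : ∀ ω, id (X ω) * X ω ^ (-(1 - q)) = X ω ^ q := fun ω ↦ by
    rw [id, mul_comm, ← rpow_add_one (hpos ω).ne']
    ring_nf
  simp only [hX'] at h
  rw [ENNReal.eq_div_iff (by simpa using hG) ENNReal.ofReal_ne_top |>.2 h,
    ← ENNReal.ofReal_div_of_pos hG]

end Stable

/-- For `A, B` i.i.d. standard positive `β`-stable variables, `(A/B)^β` has density
`sin(πβ)/(πβ(t² + 2t cos(πβ) + 1))` on `(0,∞)`. -/
theorem stmt18 {Ω : Type*} [MeasurableSpace Ω] (μ : Measure Ω) [IsProbabilityMeasure μ]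
    (β : ℝ) (hβ : β ∈ Ioo (0:ℝ) 1)
    (A B : Ω → ℝ) (hApos : ∀ ω, 0 < A ω) (hBpos : ∀ ω, 0 < B ω)
    (hAmeas : Measurable A) (hBmeas : Measurable B)
    (hInd : IndepFun A B μ)
    (hid : Measure.map A μ = Measure.map B μ)
    (hLaplace : ∀ l : ℝ, 0 ≤ l →
      ∫ ω, Real.exp (-(l * A ω)) ∂μ = Real.exp (-(l ^ β))) :
    ∀ s : Set ℝ, MeasurableSet s →
      μ {ω | (A ω / B ω) ^ β ∈ s} = ENNReal.ofReal (∫ t in s ∩ Ioi (0:ℝ),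
        Real.sin (π * β) / (π * β * (t ^ 2 + 2 * t * Real.cos (π * β) + 1))) := by
  have hβ0 := hβ.1
  have hθ : π * β ∈ Ioo (0 : ℝ) π :=
    ⟨mul_pos pi_pos hβ0, by nlinarith [pi_pos, hβ.2]⟩
  have hsin := sin_pos_of_mem_Ioo hθ
  have hQ := sq_add_two_mul_mul_cos_add_one_pos hsin
  have hLB : ∀ l : ℝ, 0 ≤ l → ∫ ω, exp (-(l * B ω)) ∂μ = exp (-(l ^ β)) := fun l hl ↦ by
    have hm (Y : Ω → ℝ) (hY : Measurable Y) :
        ∫ ω, exp (-(l * Y ω)) ∂μ = ∫ x, exp (-(l * x)) ∂(μ.map Y) :=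
      (integral_map (f := fun x ↦ exp (-(l * x))) hY.aemeasurable (by fun_prop)).symm
    rw [hm B hBmeas, ← hid, ← hm A hAmeas, hLaplace l hl]
  let f : ℝ → ℝ := fun t ↦ sin (π * β) / (π * β * (t ^ 2 + 2 * t * cos (π * β) + 1))
  have hf0 (t : ℝ) : 0 ≤ f t := div_nonneg hsin.le (mul_nonneg hθ.1.le (hQ t).le)
  have hfm : Measurable f := by fun_prop
  let D : Measure ℝ := (volume.restrict (Ioi 0)).withDensity fun t ↦ ENNReal.ofReal (f t)
  let X : Ω → ℝ := fun ω ↦ (A ω / B ω) ^ β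
  have hXm : Measurable X := by fun_prop
  have hXpos (ω : Ω) : 0 < X ω := rpow_pos_of_pos (div_pos (hApos ω) (hBpos ω)) _
  have hmomX (p : ℝ) (hp : p ∈ Ioo (0 : ℝ) 1) :
      ∫⁻ x, ENNReal.ofReal (exp (-p * x)) ∂(μ.map fun ω ↦ log (X ω)) =
        ENNReal.ofReal (Gamma p * Gamma (1 - p) * sin (p * (π * β)) / (π * β)) := by
    have hq : 0 < β * p := mul_pos hβ0 hp.1
    have hqβ : β * p < β := by nlinarith [hp.2]
    have hq1 : 0 < 1 - β * p := by linarith [hβ.2]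
    have hω (ω : Ω) : ENNReal.ofReal (exp (-p * log (X ω))) =
        ENNReal.ofReal (A ω ^ (-(β * p))) * ENNReal.ofReal (B ω ^ (β * p)) := by
      rw [← ENNReal.ofReal_mul (rpow_nonneg (hApos ω).le _), mul_comm (-p),
        ← rpow_def_of_pos (hXpos ω)]
      simp only [X]
      rw [← rpow_mul (div_pos (hApos ω) (hBpos ω)).le, div_rpow (hApos ω).le (hBpos ω).le,
        mul_neg, rpow_neg (hBpos ω).le, div_inv_eq_mul]
    have hindep : IndepFun (fun ω ↦ ENNReal.ofReal (A ω ^ (-(β * p))))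
        (fun ω ↦ ENNReal.ofReal (B ω ^ (β * p))) μ :=
      hInd.comp (φ := fun x : ℝ ↦ ENNReal.ofReal (x ^ (-(β * p))))
        (ψ := fun x : ℝ ↦ ENNReal.ofReal (x ^ (β * p))) (by fun_prop) (by fun_prop)
    rw [lintegral_map (by fun_prop) (by fun_prop), lintegral_congr hω,
      lintegral_mul_eq_lintegral_mul_lintegral_of_indepFun'' (by fun_prop) (by fun_prop) hindep,
      lintegral_rpow_neg_of_stable hβ hAmeas hApos hLaplace hq,
      lintegral_rpow_of_stable hβ hBmeas hBpos hLB hqβ, mul_div_cancel_left₀ _ hβ0.ne',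
      ← ENNReal.ofReal_mul (by positivity [Gamma_pos_of_pos hp.1, Gamma_pos_of_pos hq])]
    have hrefl := Gamma_mul_Gamma_one_sub (β * p)
    have hs : 0 < sin (π * (β * p)) := by
      refine sin_pos_of_pos_of_lt_pi (by positivity) ?_
      nlinarith [pi_pos, hβ.2]
    have := Gamma_pos_of_pos hq
    have := Gamma_pos_of_pos hq1
    congr 1
    rw [show p * (π * β) = π * (β * p) by ring]
    have hπ := pi_pos
    rw [eq_div_iff hs.ne'] at hrefl
    generalize sin (π * (β * p)) = S at hrefl hs ⊢
    field_simp
    linear_combination (-Gamma p * Gamma (1 - p)) * hrefl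
  have hmomD (p : ℝ) (hp : p ∈ Ioo (0 : ℝ) 1) :
      ∫⁻ x, ENNReal.ofReal (exp (-p * x)) ∂(D.map log) =
        ENNReal.ofReal (Gamma p * Gamma (1 - p) * sin (p * (π * β)) / (π * β)) := by
    obtain ⟨hint, hval⟩ := integral_rpow_mul_sin_div_quadratic hp hθ
    rw [lintegral_map (by fun_prop) measurable_log, ← hval, ← integral_div,
      ofReal_integral_eq_lintegral_ofReal (hint.div_const _)
        (ae_restrict_of_forall_mem measurableSet_Ioi fun t ht ↦ by
          have := hQ t
          have := rpow_nonneg (le_of_lt ht) (-p)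
          have := hθ.1
          simp only [Pi.zero_apply]
          positivity),
      lintegral_withDensity_eq_lintegral_mul _ (by fun_prop) (by fun_prop)]
    refine setLIntegral_congr_fun measurableSet_Ioi fun t ht ↦ ?_
    have ht' : 0 < t := ht
    simp only [Pi.mul_apply]
    rw [← ENNReal.ofReal_mul (hf0 t), mul_comm (-p), ← rpow_def_of_pos ht']
    congr 1
    simp only [f]
    have := hQ t
    have := pi_pos
    field_simp
  have hlog : μ.map (fun ω ↦ log (X ω)) = D.map log := by
    refine Measure.ext_of_lintegral_exp_mul (a := -1) (b := 0) (by norm_num) (fun t ht ↦ ?_)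
      fun t ht ↦ ?_
    all_goals
      have ht' : -t ∈ Ioo (0 : ℝ) 1 := ⟨by linarith [ht.2], by linarith [ht.1]⟩
      have h1 := hmomX _ ht'
      have h2 := hmomD _ ht'
      rw [neg_neg] at h1 h2
    · rw [h1]
      exact ENNReal.ofReal_ne_top
    · rw [h1, h2]
  have hlaw : μ.map X = D := by
    have h := congrArg (Measure.map exp) hlog
    rw [Measure.map_map measurable_exp (by fun_prop), Measure.map_map measurable_exp measurable_log]
      at h
    have hX : (exp ∘ fun ω ↦ log (X ω)) = X := funext fun ω ↦ exp_log (hXpos ω)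
    have hD : exp ∘ log =ᵐ[D] id := by
      refine (withDensity_absolutelyContinuous _ _).ae_le ?_
      exact ae_restrict_of_forall_mem measurableSet_Ioi fun t ht ↦ exp_log ht
    rwa [hX, Measure.map_congr hD, Measure.map_id] at h
  intro s hs
  have hDs (s : Set ℝ) (hs : MeasurableSet s) :
      D s = ∫⁻ t in s ∩ Ioi 0, ENNReal.ofReal (f t) := by
    rw [withDensity_apply _ hs, Measure.restrict_restrict hs]
  have hμ : μ {ω | (A ω / B ω) ^ β ∈ s} = D s := by
    rw [← hlaw, Measure.map_apply hXm hs]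
    rfl
  rw [hμ, hDs s hs]
  refine (ofReal_integral_eq_lintegral_ofReal ?_ (ae_of_all _ hf0)).symm
  refine (lintegral_ofReal_ne_top_iff_integrable hfm.aestronglyMeasurable (ae_of_all _ hf0)).1 ?_
  rw [← hDs s hs, ← hμ]
  exact measure_ne_top _ _
end
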